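/- arXiv:1610.01298 — 6 statements merged into one kernel-verified Lean document; each statement's English description precedes it below -/
import Mathlib

section
/- Existence and uniqueness for the continuous-time open quantum walk master equation: let M : ℓ¹(ℤ^d; M_n(ℂ)) → ℓ¹(ℤ^d; M_n(ℂ)) be the bounded linear map (Mρ)(i) = D_0 ρ(i) + ρ(i) D_0* + Σ_{r=1}^{2d} D_r ρ(i − e_r) D_r*. Then for every initial family ρ⁰ ∈ ℓ¹(ℤ^d; M_n(ℂ)) with each ρ⁰(i) positive semidefinite and Σ_{i∈ℤ^d} Tr(ρ⁰(i)) = 1, there is a unique continuously differentiable curve t ↦ ρ^{(t)} from [0,∞) into ℓ¹(ℤ^d; M_n(ℂ)) with ρ^{(0)} = ρ⁰ and d/dt ρ^{(t)} = M(ρ^{(t)}); moreover for every t ≥ 0 each ρ^{(t)}(i) is positive semidefinite and Σ_{i∈ℤ^d} Tr(ρ^{(t)}(i)) = 1. -/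
/-!
Statement 0: Existence and uniqueness for the continuous-time open quantum walk master
equation on `ℓ¹(ℤ^d; M_n(ℂ))`, together with preservation of positivity and of the
total trace.
-/

noncomputable section

open Matrix
open scoped ComplexOrder ENNReal

attribute [local instance] Matrix.frobeniusSeminormedAddCommGroup
  Matrix.frobeniusNormedAddCommGroup Matrix.frobeniusNormedSpace

local instance : Fact (1 ≤ (1 : ℝ≥0∞)) := ⟨le_rfl⟩

/-- The directions `e_1, …, e_d, -e_1, …, -e_d` as vectors in `ℤ^d`. -/
def eVecZ (d : ℕ) (r : Fin (2 * d)) : Fin d → ℤ :=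
  fun j => if (r : ℕ) = (j : ℕ) then 1 else if (r : ℕ) = d + (j : ℕ) then -1 else 0

section

open Set Filter Topology

lemma aux_exists {E : Type*} [NormedAddCommGroup E] [NormedSpace ℝ E] [CompleteSpace E]
    (M : E →L[ℝ] E) (x0 : E) :
    ∃ ρ : ℝ → E, ContDiffOn ℝ 1 ρ (Ici 0) ∧ ρ 0 = x0 ∧
      ∀ t ∈ Ici (0 : ℝ), HasDerivWithinAt ρ (M (ρ t)) (Ici 0) t := by
  have hd : ∀ t : ℝ, HasDerivAt (fun t : ℝ => NormedSpace.exp (t • M) x0)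
      (M (NormedSpace.exp (t • M) x0)) t := by
    intro t
    have h := hasDerivAt_exp_smul_const' (𝕂 := ℝ) M t
    exact ((ContinuousLinearMap.apply ℝ E x0).hasFDerivAt.comp_hasDerivAt t h)
  refine ⟨fun t => NormedSpace.exp (t • M) x0, ?_, ?_, fun t _ => (hd t).hasDerivWithinAt⟩
  · apply ContDiff.contDiffOn
    rw [contDiff_one_iff_deriv]
    refine ⟨fun t => (hd t).differentiableAt, ?_⟩
    have : deriv (fun t : ℝ => NormedSpace.exp (t • M) x0) =
        fun t => M (NormedSpace.exp (t • M) x0) := funext fun t => (hd t).deriv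
    rw [this]
    exact M.continuous.comp (continuous_iff_continuousAt.2 fun t => (hd t).continuousAt)
  · simp

lemma aux_unique {E : Type*} [NormedAddCommGroup E] [NormedSpace ℝ E]
    (M : E →L[ℝ] E) (f g : ℝ → E) (h0 : f 0 = g 0)
    (hf : ∀ t ∈ Ici (0 : ℝ), HasDerivWithinAt f (M (f t)) (Ici 0) t)
    (hg : ∀ t ∈ Ici (0 : ℝ), HasDerivWithinAt g (M (g t)) (Ici 0) t) :
    EqOn f g (Ici 0) := by
  intro t ht
  have ht' : (0 : ℝ) ≤ t := ht
  exact ODE_solution_unique (v := fun _ => M) (a := 0) (b := t) (fun _ => M.lipschitz)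
    (fun s hs => ((hf s hs.1).continuousWithinAt).mono Icc_subset_Ici_self)
    (fun s hs => (hf s hs.1).mono (Ici_subset_Ici.2 hs.1))
    (fun s hs => ((hg s hs.1).continuousWithinAt).mono Icc_subset_Ici_self)
    (fun s hs => (hg s hs.1).mono (Ici_subset_Ici.2 hs.1)) h0 ⟨ht', le_rfl⟩

lemma aux_const {E F : Type*} [NormedAddCommGroup E] [NormedSpace ℝ E]
    [NormedAddCommGroup F] [NormedSpace ℝ F]
    (M : E →L[ℝ] E) (τ : E →L[ℝ] F) (hτ : ∀ x, τ (M x) = 0) (f : ℝ → E)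
    (hf : ∀ t ∈ Ici (0 : ℝ), HasDerivWithinAt f (M (f t)) (Ici 0) t) (t : ℝ) (ht : 0 ≤ t) :
    τ (f t) = τ (f 0) := by
  have hd : ∀ s ∈ Ici (0 : ℝ), HasDerivWithinAt (fun s => τ (f s)) 0 (Ici 0) s := by
    intro s hs
    have := τ.hasFDerivAt.comp_hasDerivWithinAt s (hf s hs)
    rwa [hτ] at this
  exact constant_of_has_deriv_right_zero (a := 0) (b := t)
    (fun s hs => ((hd s hs.1).continuousWithinAt).mono Icc_subset_Ici_self)
    (fun s hs => (hd s hs.1).mono (Ici_subset_Ici.2 hs.1)) t ⟨ht, le_rfl⟩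

lemma aux_cone {E : Type*} [NormedAddCommGroup E] [NormedSpace ℝ E]
    (M K : E →L[ℝ] E) (C : Set E) (hC : IsClosed C)
    (hP : ∀ h : ℝ, 0 ≤ h → ∀ x ∈ C, x + h • M x + h ^ 2 • K x ∈ C)
    (f : ℝ → E) (h0 : f 0 ∈ C)
    (hf : ∀ t ∈ Ici (0 : ℝ), HasDerivWithinAt f (M (f t)) (Ici 0) t) (t : ℝ) (ht : 0 ≤ t) :
    f t ∈ C := by
  have hne : C.Nonempty := ⟨_, h0⟩
  set L : ℝ := ‖M‖ + ‖K‖ with hL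
  have hL0 : 0 ≤ L := by positivity
  have hstep : ∀ x : E, ∀ h : ℝ, 0 ≤ h → h ≤ 1 →
      Metric.infDist (x + h • M x + h ^ 2 • K x) C ≤ (1 + h * L) * Metric.infDist x C := by
    intro x h hh hh1
    have hpos : 0 < 1 + h * L := by positivity
    rw [← div_le_iff₀' hpos]
    rw [Metric.le_infDist hne]
    intro c hc
    rw [div_le_iff₀' hpos]
    refine (Metric.infDist_le_dist_of_mem (hP h hh c hc)).trans ?_
    rw [dist_eq_norm, dist_eq_norm]
    have e : x + h • M x + h ^ 2 • K x - (c + h • M c + h ^ 2 • K c)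
        = (x - c) + h • M (x - c) + h ^ 2 • K (x - c) := by
      simp only [map_sub, smul_sub]; abel
    rw [e]
    refine (norm_add₃_le).trans ?_
    rw [norm_smul, norm_smul, Real.norm_of_nonneg hh, Real.norm_of_nonneg (by positivity)]
    have h1 := M.le_opNorm (x - c)
    have h2 := K.le_opNorm (x - c)
    have h3 : h ^ 2 ≤ h := by nlinarith
    have h4 : h * ‖M (x - c)‖ ≤ h * (‖M‖ * ‖x - c‖) := by gcongr
    have h5 : h ^ 2 * ‖K (x - c)‖ ≤ h * (‖K‖ * ‖x - c‖) := by gcongr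
    rw [hL]; linarith
  have hg := le_gronwallBound_of_liminf_deriv_right_le
    (f := fun s => Metric.infDist (f s) C) (f' := fun s => L * Metric.infDist (f s) C)
    (δ := 0) (K := L) (ε := 0) (a := 0) (b := t)
    ((Metric.continuous_infDist_pt C).comp_continuousOn
      (fun s hs => ((hf s hs.1).continuousWithinAt).mono Icc_subset_Ici_self))
    ?_ (Metric.infDist_zero_of_mem h0).le (fun s _ => by simp) t ⟨ht, le_rfl⟩
  · rw [gronwallBound_ε0_δ0] at hg
    have : Metric.infDist (f t) C = 0 := le_antisymm hg Metric.infDist_nonneg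
    exact (hC.mem_iff_infDist_zero hne).2 this
  · intro x hx r hr
    apply Eventually.frequently
    have hder : HasDerivWithinAt f (M (f x)) (Ioi x) x :=
      (hf x hx.1).mono (fun y hy => hx.1.trans (le_of_lt hy))
    rw [hasDerivWithinAt_iff_isLittleO] at hder
    have hε : 0 < (r - L * Metric.infDist (f x) C) / 4 := by
      have : L * Metric.infDist (f x) C < r := hr
      linarith
    set ε := (r - L * Metric.infDist (f x) C) / 4 with hεd
    have hb := hder.def hε
    have hz : Tendsto (fun z : ℝ => (z - x) * ‖K (f x)‖) (𝓝[>] x) (𝓝 0) := by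
      have : Tendsto (fun z : ℝ => (z - x) * ‖K (f x)‖) (𝓝 x) (𝓝 ((x - x) * ‖K (f x)‖)) := by
        apply Continuous.tendsto; fun_prop
      simp only [sub_self, zero_mul] at this
      exact this.mono_left nhdsWithin_le_nhds
    have hs : ∀ᶠ z in 𝓝[>] x, z < x + 1 :=
      nhdsWithin_le_nhds (Iio_mem_nhds (by linarith))
    filter_upwards [hb, hz.eventually (Iio_mem_nhds hε), hs, self_mem_nhdsWithin]
      with z h1 h2 h3 h4
    have h4' : x < z := h4
    have hpos : 0 < z - x := by linarith
    rw [inv_mul_lt_iff₀ hpos]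
    have h2' : (z - x) * ‖K (f x)‖ < ε := h2
    rw [Real.norm_of_nonneg hpos.le] at h1
    have k1 := hstep (f x) (z - x) hpos.le (by linarith)
    have k2 := Metric.infDist_le_infDist_add_dist (s := C) (x := f z)
      (y := f x + (z - x) • M (f x) + (z - x) ^ 2 • K (f x))
    have k3 : dist (f z) (f x + (z - x) • M (f x) + (z - x) ^ 2 • K (f x))
        ≤ ε * (z - x) + (z - x) ^ 2 * ‖K (f x)‖ := by
      rw [dist_eq_norm]
      have e : f z - (f x + (z - x) • M (f x) + (z - x) ^ 2 • K (f x))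
        = (f z - f x - (z - x) • M (f x)) - (z - x) ^ 2 • K (f x) := by abel
      rw [e]
      refine (norm_sub_le _ _).trans ?_
      rw [norm_smul (_ ^ 2), Real.norm_of_nonneg (by positivity : 0 ≤ (z - x) ^ 2)]
      gcongr
    have k4 : (z - x) ^ 2 * ‖K (f x)‖ ≤ (z - x) * ε := by
      rw [sq, mul_assoc]; gcongr
    have k5 : r = 4 * ε + L * Metric.infDist (f x) C := by rw [hεd]; ring
    rw [k5]
    nlinarith [mul_pos hpos hε]

end

lemma aux_isClosed_posSemidef (n : ℕ) :
    IsClosed {A : Matrix (Fin n) (Fin n) ℂ | A.PosSemidef} := by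
  have : {A : Matrix (Fin n) (Fin n) ℂ | A.PosSemidef} =
      {A | Aᴴ = A} ∩ ⋂ x : Fin n → ℂ, {A | 0 ≤ star x ⬝ᵥ (A *ᵥ x)} := by
    ext A
    simp only [Set.mem_ofPred_eq, Set.mem_inter_iff, Set.mem_iInter]
    exact Matrix.posSemidef_iff_dotProduct_mulVec
  rw [this]
  refine IsClosed.inter (isClosed_eq (by fun_prop) (by fun_prop)) (isClosed_iInter fun x => ?_)
  exact isClosed_le continuous_const (by fun_prop)

lemma aux_step (n m : ℕ) (D : Fin m → Matrix (Fin n) (Fin n) ℂ)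
    (D₀ A : Matrix (Fin n) (Fin n) ℂ) (hA : A.PosSemidef)
    (B : Fin m → Matrix (Fin n) (Fin n) ℂ) (hB : ∀ r, (B r).PosSemidef) (h : ℝ) (hh : 0 ≤ h) :
    (A + h • (D₀ * A + A * D₀ᴴ + ∑ r, D r * B r * (D r)ᴴ) + h ^ 2 • (D₀ * A * D₀ᴴ)).PosSemidef := by
  have e : A + h • (D₀ * A + A * D₀ᴴ + ∑ r, D r * B r * (D r)ᴴ) + h ^ 2 • (D₀ * A * D₀ᴴ)
      = (1 + h • D₀) * A * (1 + h • D₀)ᴴ + h • ∑ r, D r * B r * (D r)ᴴ := by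
    simp only [conjTranspose_add, conjTranspose_one, conjTranspose_smul, star_trivial, add_mul,
      mul_add, one_mul, mul_one, smul_add, smul_mul_assoc, mul_smul_comm, smul_smul, sq]
    abel
  rw [e]
  refine (hA.mul_mul_conjTranspose_same _).add (Matrix.PosSemidef.smul ?_ hh)
  exact Matrix.posSemidef_sum _ fun r _ => (hB r).mul_mul_conjTranspose_same _

lemma aux_trace (n m : ℕ) (D : Fin m → Matrix (Fin n) (Fin n) ℂ)
    (H₀ : Matrix (Fin n) (Fin n) ℂ) (hH₀ : H₀.IsHermitian)
    (D₀ : Matrix (Fin n) (Fin n) ℂ)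
    (hD₀ : D₀ = -(Complex.I • H₀) - (2⁻¹ : ℂ) • ∑ r, (D r)ᴴ * D r)
    (S : Matrix (Fin n) (Fin n) ℂ) :
    (D₀ * S + S * D₀ᴴ + ∑ r, D r * S * (D r)ᴴ).trace = 0 := by
  have h1 : D₀ + D₀ᴴ + ∑ r, (D r)ᴴ * D r = 0 := by
    rw [hD₀]
    simp only [conjTranspose_sub, conjTranspose_neg, conjTranspose_smul, hH₀.eq,
      conjTranspose_sum, conjTranspose_mul, conjTranspose_conjTranspose]
    have : star (2⁻¹ : ℂ) = 2⁻¹ := by simp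
    rw [this, Complex.star_def, Complex.conj_I]
    module
  have h2 : (D₀ * S + S * D₀ᴴ + ∑ r, D r * S * (D r)ᴴ).trace
      = ((D₀ + D₀ᴴ + ∑ r, (D r)ᴴ * D r) * S).trace := by
    simp only [add_mul, trace_add, Finset.sum_mul, trace_sum]
    congr 1
    · rw [trace_mul_comm S]
    · refine Finset.sum_congr rfl fun r _ => ?_
      rw [trace_mul_comm, ← mul_assoc]
  rw [h2, h1, zero_mul, trace_zero]

lemma aux_summable {ι : Type*} (n : ℕ)
    (ρ : lp (fun _ : ι => Matrix (Fin n) (Fin n) ℂ) 1) : Summable (fun i => ρ i) := by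
  have h := (lp.memℓp ρ).summable (by simp)
  refine Summable.of_norm ?_
  simpa using h

lemma aux_map {ι E : Type*} [NormedAddCommGroup E] [NormedSpace ℝ E] [FiniteDimensional ℝ E]
    (T : E →ₗ[ℝ] E) :
    ∃ K : lp (fun _ : ι => E) 1 →L[ℝ] lp (fun _ : ι => E) 1, ∀ ρ i, K ρ i = T (ρ i) :=
  ⟨lp.mapCLM 1 (fun _ => T.toContinuousLinearMap) (norm_nonneg T.toContinuousLinearMap)
    (fun _ => le_rfl), fun _ _ => rfl⟩

lemma aux_tsum {ι E : Type*} [NormedAddCommGroup E] [NormedSpace ℝ E] [FiniteDimensional ℝ E]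
    (T : E →ₗ[ℝ] ℂ) :
    ∃ τ : lp (fun _ : ι => E) 1 →L[ℝ] ℂ, (∀ ρ, τ ρ = T (∑' i, ρ i)) ∧
      ∀ ρ : lp (fun _ : ι => E) 1, HasSum (fun i => T (ρ i)) (τ ρ) := by
  have : CompleteSpace E := FiniteDimensional.complete ℝ E
  refine ⟨T.toContinuousLinearMap.comp (lp.tsumCLM (α := ι) (𝕜 := ℝ) (E := E)), fun _ => rfl, fun ρ => ?_⟩
  have h := (lp.memℓp ρ).summable (by simp)
  have hs : Summable (fun i => ρ i) := Summable.of_norm (by simpa using h)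
  exact T.toContinuousLinearMap.hasSum hs.hasSum

lemma aux_complete {ι E : Type*} [NormedAddCommGroup E] [NormedSpace ℝ E]
    [FiniteDimensional ℝ E] : CompleteSpace (lp (fun _ : ι => E) 1) := by
  have : CompleteSpace E := FiniteDimensional.complete ℝ E
  infer_instance

theorem stmt_0 (n d : ℕ) (hn : 1 ≤ n) (hd : 1 ≤ d)
    (D : Fin (2 * d) → Matrix (Fin n) (Fin n) ℂ)
    (H₀ : Matrix (Fin n) (Fin n) ℂ) (hH₀ : H₀.IsHermitian)
    (D₀ : Matrix (Fin n) (Fin n) ℂ)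
    (hD₀ : D₀ = -(Complex.I • H₀) - (2⁻¹ : ℂ) • ∑ r, (D r)ᴴ * D r)
    -- the bounded linear map `M` on `ℓ¹(ℤ^d; M_n(ℂ))`
    (M : lp (fun _ : Fin d → ℤ => Matrix (Fin n) (Fin n) ℂ) 1 →L[ℂ]
         lp (fun _ : Fin d → ℤ => Matrix (Fin n) (Fin n) ℂ) 1)
    (hM : ∀ (ρ : lp (fun _ : Fin d → ℤ => Matrix (Fin n) (Fin n) ℂ) 1) (i : Fin d → ℤ),
      M ρ i = D₀ * ρ i + ρ i * D₀ᴴ + ∑ r, D r * ρ (i - eVecZ d r) * (D r)ᴴ)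
    -- the initial condition
    (ρ0 : lp (fun _ : Fin d → ℤ => Matrix (Fin n) (Fin n) ℂ) 1)
    (hρ0_pos : ∀ i, (ρ0 i).PosSemidef)
    (hρ0_tr : HasSum (fun i => (ρ0 i).trace) 1) :
    -- existence
    (∃ ρ : ℝ → lp (fun _ : Fin d → ℤ => Matrix (Fin n) (Fin n) ℂ) 1,
      ContDiffOn ℝ 1 ρ (Set.Ici 0) ∧ ρ 0 = ρ0 ∧
      ∀ t ∈ Set.Ici (0 : ℝ), HasDerivWithinAt ρ (M (ρ t)) (Set.Ici 0) t) ∧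
    -- uniqueness (as curves defined on `[0,∞)`)
    (∀ ρ₁ ρ₂ : ℝ → lp (fun _ : Fin d → ℤ => Matrix (Fin n) (Fin n) ℂ) 1,
      (ContDiffOn ℝ 1 ρ₁ (Set.Ici 0) ∧ ρ₁ 0 = ρ0 ∧
        ∀ t ∈ Set.Ici (0 : ℝ), HasDerivWithinAt ρ₁ (M (ρ₁ t)) (Set.Ici 0) t) →
      (ContDiffOn ℝ 1 ρ₂ (Set.Ici 0) ∧ ρ₂ 0 = ρ0 ∧
        ∀ t ∈ Set.Ici (0 : ℝ), HasDerivWithinAt ρ₂ (M (ρ₂ t)) (Set.Ici 0) t) →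
      Set.EqOn ρ₁ ρ₂ (Set.Ici 0)) ∧
    -- positivity and total trace are preserved along the solution
    (∀ ρ : ℝ → lp (fun _ : Fin d → ℤ => Matrix (Fin n) (Fin n) ℂ) 1,
      (ContDiffOn ℝ 1 ρ (Set.Ici 0) ∧ ρ 0 = ρ0 ∧
        ∀ t ∈ Set.Ici (0 : ℝ), HasDerivWithinAt ρ (M (ρ t)) (Set.Ici 0) t) →
      ∀ t ∈ Set.Ici (0 : ℝ),
        (∀ i, ((ρ t) i).PosSemidef) ∧ HasSum (fun i => ((ρ t) i).trace) 1) := by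
  set MR := M.restrictScalars ℝ with hMR
  -- the conjugation `ρ ↦ D₀ ρ D₀*` on matrices
  let T : Matrix (Fin n) (Fin n) ℂ →ₗ[ℝ] Matrix (Fin n) (Fin n) ℂ :=
    { toFun := fun A => D₀ * A * D₀ᴴ
      map_add' := fun A B => by rw [mul_add, add_mul]
      map_smul' := fun c A => by simp }
  obtain ⟨K, hK'⟩ := aux_map (ι := Fin d → ℤ) T
  have hK : ∀ ρ i, K ρ i = D₀ * ρ i * D₀ᴴ := hK'
  obtain ⟨τ, hτ', hτs'⟩ := aux_tsum (ι := Fin d → ℤ) (Matrix.traceLinearMap (Fin n) ℝ ℂ)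
  have hτ : ∀ ρ, τ ρ = (∑' i, ρ i).trace := hτ'
  have hτs : ∀ ρ : lp (fun _ : Fin d → ℤ => Matrix (Fin n) (Fin n) ℂ) 1,
      HasSum (fun i => (ρ i).trace) (τ ρ) := hτs'
  have hτM : ∀ ρ, τ (MR ρ) = 0 := by
    intro ρ
    rw [hτ]
    have hS := (aux_summable n ρ).hasSum
    have h1 : HasSum (fun i => MR ρ i) (D₀ * (∑' i, ρ i) + (∑' i, ρ i) * D₀ᴴ
        + ∑ r, D r * (∑' i, ρ i) * (D r)ᴴ) := by
      have e : (fun i => MR ρ i) = fun i => D₀ * ρ i + ρ i * D₀ᴴ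
          + ∑ r, D r * ρ (i - eVecZ d r) * (D r)ᴴ := funext fun i => hM ρ i
      rw [e]
      refine ((hS.mul_left D₀).add (hS.mul_right D₀ᴴ)).add (hasSum_sum fun r _ => ?_)
      have hS' : HasSum (fun i => ρ (i - eVecZ d r)) (∑' i, ρ i) :=
        ((Equiv.subRight (eVecZ d r)).hasSum_iff).2 hS
      exact (hS'.mul_left (D r)).mul_right _
    rw [h1.tsum_eq]
    exact aux_trace n (2 * d) D H₀ hH₀ D₀ hD₀ _
  have hcomp : CompleteSpace (lp (fun _ : Fin d → ℤ => Matrix (Fin n) (Fin n) ℂ) 1) :=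
    aux_complete
  refine ⟨aux_exists MR ρ0, fun ρ₁ ρ₂ h₁ h₂ =>
    aux_unique MR ρ₁ ρ₂ (h₁.2.1.trans h₂.2.1.symm) h₁.2.2 h₂.2.2, ?_⟩
  rintro ρ ⟨-, h0, hd⟩ t ht
  constructor
  · refine aux_cone MR K {x | ∀ i, (x i).PosSemidef} ?_ ?_ ρ (by rw [h0]; exact hρ0_pos) hd t ht
    · rw [Set.ofPred_forall]
      refine isClosed_iInter fun i => ?_
      have hc : Continuous
          (fun x : lp (fun _ : Fin d → ℤ => Matrix (Fin n) (Fin n) ℂ) 1 => x i) :=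
        (lp.evalCLM ℝ (fun _ : Fin d → ℤ => Matrix (Fin n) (Fin n) ℂ) 1 i).continuous
      exact (aux_isClosed_posSemidef n).preimage hc
    · intro h hh x hx i
      have e : (x + h • MR x + h ^ 2 • K x) i = x i + h • (D₀ * x i + x i * D₀ᴴ
          + ∑ r, D r * x (i - eVecZ d r) * (D r)ᴴ) + h ^ 2 • (D₀ * x i * D₀ᴴ) := by
        rw [← hM x i, ← hK x i]; rfl
      rw [e]
      exact aux_step n (2 * d) D D₀ (x i) (hx i) _ (fun r => hx _) h hh
  · have := hτs (ρ t)
    rw [aux_const MR τ hτM ρ hd t ht, h0, (hτs ρ0).unique hρ0_tr] at this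
    exact this
end
end

section
/- Existence of the solution of the deformed adjoint-Lindblad equation: assume (H1). Then for every u ∈ ℝ^d there exists J ∈ M_n(ℂ) such that L*(J) = −( Σ_{r=1}^{2d} (e_r·u) D_r*D_r − (m·u) I ). -/
/-!
Statement 1: Existence of the solution of the deformed adjoint-Lindblad equation.
Context: `D 0, …, D (2d-1)` are the jump operators `D_1, …, D_{2d}`,
`D₀ = -i H₀ - (1/2) Σ_r D_r* D_r`, `L(ρ) = D₀ρ + ρD₀* + Σ_r D_r ρ D_r*`,
`L*(X) = D₀* X + X D₀ + Σ_r D_r* X D_r`.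
(H1): there is a unique density matrix `ρinv` with `L ρinv = 0`, and `dim ker L = 1`.
`m = Σ_r Tr(D_r ρinv D_r*) e_r ∈ ℝ^d`.
-/

open Matrix
open scoped ComplexOrder

/-- The directions `e_1, …, e_d, -e_1, …, -e_d` as vectors in `ℝ^d`. -/
def eVec (d : ℕ) (r : Fin (2 * d)) : Fin d → ℝ :=
  fun j => if (r : ℕ) = (j : ℕ) then 1 else if (r : ℕ) = d + (j : ℕ) then -1 else 0

/-- Every linear functional on matrices is of the form `X ↦ Tr (J X)`. -/
theorem exists_trace_rep {n : ℕ} (ψ : Matrix (Fin n) (Fin n) ℂ →ₗ[ℂ] ℂ) :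
    ∃ J : Matrix (Fin n) (Fin n) ℂ, ∀ X, ψ X = (J * X).trace := by
  refine ⟨Matrix.of fun i j => ψ (Matrix.single j i 1), fun X => ?_⟩
  conv_lhs => rw [Matrix.matrix_eq_sum_single X]
  simp only [map_sum, Matrix.trace, Matrix.diag_apply, Matrix.mul_apply, Matrix.of_apply]
  rw [Finset.sum_comm]
  refine Finset.sum_congr rfl fun i _ => Finset.sum_congr rfl fun j _ => ?_
  have : Matrix.single j i (X j i) = X j i • Matrix.single j i (1 : ℂ) := by
    rw [Matrix.smul_single, smul_eq_mul, mul_one]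
  rw [this, map_smul, smul_eq_mul, mul_comm]

theorem stmt_1 (n d : ℕ) (hn : 1 ≤ n) (hd : 1 ≤ d)
    (D : Fin (2 * d) → Matrix (Fin n) (Fin n) ℂ)
    (H₀ : Matrix (Fin n) (Fin n) ℂ) (hH₀ : H₀.IsHermitian)
    (D₀ : Matrix (Fin n) (Fin n) ℂ)
    (hD₀ : D₀ = -(Complex.I • H₀) - (2⁻¹ : ℂ) • ∑ r, (D r)ᴴ * D r)
    -- the Lindblad operator
    (L : Matrix (Fin n) (Fin n) ℂ →ₗ[ℂ] Matrix (Fin n) (Fin n) ℂ)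
    (hL : ∀ ρ, L ρ = D₀ * ρ + ρ * D₀ᴴ + ∑ r, D r * ρ * (D r)ᴴ)
    -- hypothesis (H1)
    (ρinv : Matrix (Fin n) (Fin n) ℂ)
    (hinv_pos : ρinv.PosSemidef) (hinv_tr : ρinv.trace = 1) (hinv : L ρinv = 0)
    (huniq : ∀ ρ : Matrix (Fin n) (Fin n) ℂ,
      ρ.PosSemidef → ρ.trace = 1 → L ρ = 0 → ρ = ρinv)
    (hker : Module.finrank ℂ (LinearMap.ker L) = 1)
    -- the mean vector m
    (m : Fin d → ℝ)
    (hm : ∀ j, m j = ∑ r, (Matrix.trace (D r * ρinv * (D r)ᴴ)).re * eVec d r j)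
    (u : Fin d → ℝ) :
    ∃ J : Matrix (Fin n) (Fin n) ℂ,
      D₀ᴴ * J + J * D₀ + ∑ r, (D r)ᴴ * J * D r =
        -((∑ r, ((∑ j, eVec d r j * u j : ℝ) : ℂ) • ((D r)ᴴ * D r)) -
            ((∑ j, m j * u j : ℝ) : ℂ) • (1 : Matrix (Fin n) (Fin n) ℂ)) := by
  set A : Matrix (Fin n) (Fin n) ℂ :=
    -((∑ r, ((∑ j, eVec d r j * u j : ℝ) : ℂ) • ((D r)ᴴ * D r)) -
            ((∑ j, m j * u j : ℝ) : ℂ) • (1 : Matrix (Fin n) (Fin n) ℂ)) with hA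
  have hreal : ∀ r, (((Matrix.trace (D r * ρinv * (D r)ᴴ)).re : ℝ) : ℂ)
      = Matrix.trace (D r * ρinv * (D r)ᴴ) := by
    intro r
    have h := (hinv_pos.mul_mul_conjTranspose_same (D r)).trace_nonneg
    have h2 := (Complex.le_def.mp h).2
    apply Complex.ext
    · simp
    · simpa using h2
  have hAρ : (A * ρinv).trace = 0 := by
    have h1 : ∀ r, ((D r)ᴴ * D r * ρinv).trace = (D r * ρinv * (D r)ᴴ).trace := by
      intro r
      rw [Matrix.mul_assoc, Matrix.trace_mul_comm]
    have h2 : (∑ j, m j * u j : ℝ) =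
        ∑ r, (∑ j, eVec d r j * u j) * (Matrix.trace (D r * ρinv * (D r)ᴴ)).re := by
      simp only [hm, Finset.sum_mul]
      rw [Finset.sum_comm]
      refine Finset.sum_congr rfl fun i _ => Finset.sum_congr rfl fun j _ => ?_
      ring
    rw [hA, h2, Matrix.neg_mul, Matrix.sub_mul, Matrix.trace_neg, Matrix.trace_sub,
      Matrix.sum_mul, Matrix.trace_sum, Matrix.smul_mul, Matrix.one_mul, Matrix.trace_smul,
      hinv_tr, Complex.ofReal_sum]
    simp only [Matrix.smul_mul, Matrix.trace_smul, h1, smul_eq_mul, mul_one, Complex.ofReal_mul,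
      hreal, sub_self, neg_zero]
  have hρ0 : ρinv ≠ 0 := by
    rintro rfl
    simp at hinv_tr
  let φ : Module.Dual ℂ (Matrix (Fin n) (Fin n) ℂ) :=
    (Matrix.traceLinearMap (Fin n) ℂ ℂ).comp (LinearMap.mulLeft ℂ A)
  have hφ : ∀ X, φ X = (A * X).trace := fun X => rfl
  have hφmem : φ ∈ LinearMap.range L.dualMap := by
    rw [LinearMap.range_dualMap_eq_dualAnnihilator_ker, Submodule.mem_dualAnnihilator]
    intro w hw
    obtain ⟨c, hc⟩ := (finrank_eq_one_iff_of_nonzero' (⟨ρinv, hinv⟩ : LinearMap.ker L)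
      (by simpa [Subtype.ext_iff] using hρ0)).mp hker ⟨w, hw⟩
    have hc' : c • ρinv = w := congrArg Subtype.val hc
    rw [← hc', map_smul, hφ, hAρ, smul_zero]
  obtain ⟨ψ, hψ⟩ := hφmem
  obtain ⟨J, hJ⟩ := exists_trace_rep ψ
  refine ⟨J, ?_⟩
  rw [Matrix.ext_iff_trace_mul_right]
  intro X
  rw [← hφ, ← hψ, LinearMap.dualMap_apply, hJ, hL]
  simp only [Matrix.add_mul, Matrix.mul_add, Matrix.sum_mul, Matrix.mul_sum, Matrix.trace_add,
    Matrix.trace_sum]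
  have e1 : (D₀ᴴ * J * X).trace = (J * (X * D₀ᴴ)).trace := by
    rw [Matrix.mul_assoc, Matrix.trace_mul_comm, Matrix.mul_assoc]
  have e2 : ∀ r, ((D r)ᴴ * J * D r * X).trace = (J * (D r * X * (D r)ᴴ)).trace := by
    intro r
    rw [Matrix.mul_assoc, Matrix.mul_assoc, Matrix.trace_mul_comm, Matrix.mul_assoc]
  simp only [e1, e2, Matrix.mul_assoc J D₀ X]
  ring
end

section
/- Solution of the Poisson equation: assume (H1), fix u ∈ ℝ^d, and let J_u be the unique trace-zero matrix with L*(J_u) = −( Σ_{r=1}^{2d} (e_r·u) D_r*D_r − (m·u) I ). Then for every density matrix ρ and every x ∈ ℤ^d, the generator applied to f_u(ρ,x) = Tr(ρ J_u) + x·u equals m·u; explicitly, Tr( (D_0ρ + ρD_0* − Tr(D_0ρ + ρD_0*) ρ) J_u ) + Σ_{r=1}^{2d} [ Tr(D_rρD_r* J_u) + ( (x+e_r)·u − Tr(ρ J_u) − x·u ) Tr(D_rρD_r*) ] = m·u. -/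
/-!
Statement 5: Solution of the Poisson equation: the generator applied to
`f_u(ρ,x) = Tr(ρ J_u) + x·u` equals `m·u`.
Context: `D 0, …, D (2d-1)` are the jump operators `D_1, …, D_{2d}`,
`D₀ = -i H₀ - (1/2) Σ_r D_r* D_r`, `L(ρ) = D₀ρ + ρD₀* + Σ_r D_r ρ D_r*`,
`L*(X) = D₀* X + X D₀ + Σ_r D_r* X D_r`.
(H1): there is a unique density matrix `ρinv` with `L ρinv = 0`, and `dim ker L = 1`.
`m = Σ_r Tr(D_r ρinv D_r*) e_r ∈ ℝ^d`.
-/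

open Matrix
open scoped ComplexOrder

theorem stmt_5 (n d : ℕ) (hn : 1 ≤ n) (hd : 1 ≤ d)
    (D : Fin (2 * d) → Matrix (Fin n) (Fin n) ℂ)
    (H₀ : Matrix (Fin n) (Fin n) ℂ) (hH₀ : H₀.IsHermitian)
    (D₀ : Matrix (Fin n) (Fin n) ℂ)
    (hD₀ : D₀ = -(Complex.I • H₀) - (2⁻¹ : ℂ) • ∑ r, (D r)ᴴ * D r)
    -- the Lindblad operator
    (L : Matrix (Fin n) (Fin n) ℂ →ₗ[ℂ] Matrix (Fin n) (Fin n) ℂ)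
    (hL : ∀ ρ, L ρ = D₀ * ρ + ρ * D₀ᴴ + ∑ r, D r * ρ * (D r)ᴴ)
    -- hypothesis (H1)
    (ρinv : Matrix (Fin n) (Fin n) ℂ)
    (hinv_pos : ρinv.PosSemidef) (hinv_tr : ρinv.trace = 1) (hinv : L ρinv = 0)
    (huniq : ∀ ρ : Matrix (Fin n) (Fin n) ℂ,
      ρ.PosSemidef → ρ.trace = 1 → L ρ = 0 → ρ = ρinv)
    (hker : Module.finrank ℂ (LinearMap.ker L) = 1)
    -- the mean vector m
    (m : Fin d → ℝ)
    (hm : ∀ j, m j = ∑ r, (Matrix.trace (D r * ρinv * (D r)ᴴ)).re * eVec d r j)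
    (u : Fin d → ℝ)
    -- `J` is the unique trace-zero solution of the deformed adjoint-Lindblad equation at `u`
    (J : Matrix (Fin n) (Fin n) ℂ) (hJtr : J.trace = 0)
    (hJeq : D₀ᴴ * J + J * D₀ + ∑ r, (D r)ᴴ * J * D r =
        -((∑ r, ((∑ j, eVec d r j * u j : ℝ) : ℂ) • ((D r)ᴴ * D r)) -
            ((∑ j, m j * u j : ℝ) : ℂ) • (1 : Matrix (Fin n) (Fin n) ℂ)))
    -- a density matrix `ρ` and a position `x ∈ ℤ^d`
    (ρ : Matrix (Fin n) (Fin n) ℂ) (hρ_pos : ρ.PosSemidef) (hρ_tr : ρ.trace = 1)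
    (x : Fin d → ℤ) :
    Matrix.trace
        ((D₀ * ρ + ρ * D₀ᴴ - Matrix.trace (D₀ * ρ + ρ * D₀ᴴ) • ρ) * J) +
      ∑ r, (Matrix.trace (D r * ρ * (D r)ᴴ * J) +
        (((∑ j, ((x j : ℝ) + eVec d r j) * u j : ℝ) : ℂ) - Matrix.trace (ρ * J) -
            ((∑ j, (x j : ℝ) * u j : ℝ) : ℂ)) * Matrix.trace (D r * ρ * (D r)ᴴ)) =
      ((∑ j, m j * u j : ℝ) : ℂ) := by
  have h0 : D₀ + D₀ᴴ = -∑ r, (D r)ᴴ * D r := by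
    have hS : (∑ r, (D r)ᴴ * D r)ᴴ = ∑ r, (D r)ᴴ * D r := by
      simp [Matrix.conjTranspose_sum, Matrix.conjTranspose_mul]
    have h2 : (star (2⁻¹ : ℂ)) = 2⁻¹ := by simp
    rw [hD₀, Matrix.conjTranspose_sub, Matrix.conjTranspose_neg, Matrix.conjTranspose_smul,
      Matrix.conjTranspose_smul, hS, hH₀.eq, h2]
    ext i j
    simp
    ring
  have ht : ∀ r, Matrix.trace (D r * ρ * (D r)ᴴ) = Matrix.trace (ρ * ((D r)ᴴ * D r)) := by
    intro r
    rw [Matrix.mul_assoc, Matrix.trace_mul_comm, Matrix.mul_assoc]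
  have htJ : ∀ r, Matrix.trace (D r * ρ * (D r)ᴴ * J) =
      Matrix.trace (ρ * ((D r)ᴴ * J * D r)) := by
    intro r
    rw [Matrix.mul_assoc, Matrix.mul_assoc, Matrix.trace_mul_comm, Matrix.mul_assoc]
  have h1 : Matrix.trace (D₀ * ρ + ρ * D₀ᴴ) = -∑ r, Matrix.trace (ρ * ((D r)ᴴ * D r)) := by
    rw [Matrix.trace_add, Matrix.trace_mul_comm D₀ ρ, ← Matrix.trace_add, ← Matrix.mul_add, h0,
      Matrix.mul_neg, Matrix.trace_neg, Matrix.mul_sum, Matrix.trace_sum]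
  have h3 := congrArg (fun M => Matrix.trace (ρ * M)) hJeq
  simp only [Matrix.mul_add, Matrix.trace_add, Matrix.mul_neg, Matrix.trace_neg, Matrix.mul_sub,
    Matrix.trace_sub, Matrix.mul_sum, Matrix.trace_sum, Matrix.mul_smul, Matrix.trace_smul,
    Matrix.mul_one, hρ_tr, smul_eq_mul, mul_one] at h3
  have h4 : Matrix.trace (D₀ * ρ * J) = Matrix.trace (ρ * (J * D₀)) := by
    rw [Matrix.mul_assoc, Matrix.trace_mul_comm, Matrix.mul_assoc]
  have h5 : ∀ r, ((∑ j, ((x j : ℝ) + eVec d r j) * u j : ℝ) : ℂ) =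
      ((∑ j, (x j : ℝ) * u j : ℝ) : ℂ) + ((∑ j, eVec d r j * u j : ℝ) : ℂ) := by
    intro r
    rw [← Complex.ofReal_add, ← Finset.sum_add_distrib]
    simp only [add_mul]
  rw [Matrix.sub_mul, Matrix.trace_sub, Matrix.smul_mul, Matrix.trace_smul, h1, Matrix.add_mul,
    Matrix.trace_add, h4, Matrix.mul_assoc ρ]
  simp only [ht, htJ, h5, smul_eq_mul]
  generalize ((∑ j, m j * u j : ℝ) : ℂ) = mu at *
  generalize ((∑ j, (x j : ℝ) * u j : ℝ) : ℂ) = xu at *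
  have h6 : ∀ r, (xu + ((∑ j, eVec d r j * u j : ℝ) : ℂ) - Matrix.trace (ρ * J) - xu) *
      Matrix.trace (ρ * ((D r)ᴴ * D r)) =
      ((∑ j, eVec d r j * u j : ℝ) : ℂ) * Matrix.trace (ρ * ((D r)ᴴ * D r)) -
      Matrix.trace (ρ * J) * Matrix.trace (ρ * ((D r)ᴴ * D r)) := by
    intro r
    ring
  simp only [h6, Finset.sum_add_distrib, Finset.sum_sub_distrib, ← Finset.mul_sum]
  linear_combination h3
end

section
/- Analyticity of the leading eigenvalue: assume φ(ρ) = Σ_{r=1}^{2d} D_rρD_r* is irreducible. Then the function ℝ^d → ℝ, u ↦ l_u := max{ Re λ : λ ∈ spectrum of L^(u) }, is real-analytic on ℝ^d. -/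
/-!
Statement 10: Analyticity of the leading eigenvalue: if `φ` is irreducible then
`u ↦ l_u = max{ Re λ : λ ∈ spectrum L^(u) }` is real-analytic on `ℝ^d`.
-/

noncomputable section

open Matrix
open scoped ComplexOrder

attribute [local instance] Matrix.frobeniusSeminormedAddCommGroup
  Matrix.frobeniusNormedAddCommGroup Matrix.frobeniusNormedSpace

/-- A completely positive map `ρ ↦ Σ_r A_r ρ A_r*` is irreducible if for every nonzero
`x ∈ ℂ^n` the smallest subspace of `ℂ^n` containing `x` and invariant under every `A_r`
is `ℂ^n` itself. -/
def KrausIrreducible {n k : ℕ} (A : Fin k → Matrix (Fin n) (Fin n) ℂ) : Prop :=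
  ∀ x : Fin n → ℂ, x ≠ 0 →
    ∀ W : Submodule ℂ (Fin n → ℂ), x ∈ W →
      (∀ r : Fin k, ∀ v ∈ W, (A r) *ᵥ v ∈ W) → W = ⊤


namespace PF

variable {n k : ℕ}

/-- The quadratic form. -/
def qf (X : Matrix (Fin n) (Fin n) ℂ) (v : Fin n → ℂ) : ℂ := star v ⬝ᵥ (X *ᵥ v)

lemma qf_add (X Y : Matrix (Fin n) (Fin n) ℂ) (v) : qf (X + Y) v = qf X v + qf Y v := by
  simp [qf, Matrix.add_mulVec, dotProduct_add]

lemma qf_sub (X Y : Matrix (Fin n) (Fin n) ℂ) (v) : qf (X - Y) v = qf X v - qf Y v := by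
  simp [qf, Matrix.sub_mulVec, dotProduct_sub]

lemma qf_neg (X : Matrix (Fin n) (Fin n) ℂ) (v) : qf (-X) v = - qf X v := by
  simp [qf, Matrix.neg_mulVec, dotProduct_neg]

lemma qf_smul (c : ℂ) (X : Matrix (Fin n) (Fin n) ℂ) (v) : qf (c • X) v = c * qf X v := by
  simp [qf, Matrix.smul_mulVec, dotProduct_smul]

lemma qf_sum {ι : Type*} (s : Finset ι) (X : ι → Matrix (Fin n) (Fin n) ℂ) (v) :
    qf (∑ i ∈ s, X i) v = ∑ i ∈ s, qf (X i) v := by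
  classical
  induction s using Finset.induction_on with
  | empty => simp [qf]
  | insert a s ha ih => rw [Finset.sum_insert ha, Finset.sum_insert ha, qf_add, ih]

lemma qf_conj (X : Matrix (Fin n) (Fin n) ℂ) (v) : qf Xᴴ v = star (qf X v) := by
  unfold qf
  rw [Matrix.star_dotProduct, star_mulVec, Matrix.dotProduct_mulVec]
  simp

lemma qf_smul_vec (c : ℂ) (X : Matrix (Fin n) (Fin n) ℂ) (v) :
    qf X (c • v) = (star c * c) * qf X v := by
  simp [qf, Matrix.mulVec_smul, dotProduct_smul, smul_dotProduct, mul_assoc]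
  ring

lemma continuous_qf : Continuous (fun p : Matrix (Fin n) (Fin n) ℂ × (Fin n → ℂ) => qf p.1 p.2) := by
  unfold qf
  fun_prop

lemma psd_of {X : Matrix (Fin n) (Fin n) ℂ} (h : X.IsHermitian) (h2 : ∀ v, 0 ≤ (qf X v).re) :
    X.PosSemidef := by
  refine Matrix.PosSemidef.of_dotProduct_mulVec_nonneg h fun v => ?_
  have := h.im_star_dotProduct_mulVec_self v
  exact Complex.le_def.2 ⟨h2 v, this.symm⟩

lemma pd_of {X : Matrix (Fin n) (Fin n) ℂ} (h : X.IsHermitian) (h2 : ∀ v, v ≠ 0 → 0 < (qf X v).re) :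
    X.PosDef := by
  refine Matrix.PosDef.of_dotProduct_mulVec_pos h fun v hv => ?_
  have := h.im_star_dotProduct_mulVec_self v
  exact Complex.lt_def.2 ⟨h2 v hv, this.symm⟩

lemma psd_re {X : Matrix (Fin n) (Fin n) ℂ} (h : X.PosSemidef) (v) : 0 ≤ (qf X v).re :=
  (Complex.le_def.1 (h.dotProduct_mulVec_nonneg v)).1

lemma pd_re {X : Matrix (Fin n) (Fin n) ℂ} (h : X.PosDef) {v} (hv : v ≠ 0) : 0 < (qf X v).re :=
  (Complex.lt_def.1 (h.dotProduct_mulVec_pos hv)).1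

lemma herm_im {X : Matrix (Fin n) (Fin n) ℂ} (h : X.IsHermitian) (v) : (qf X v).im = 0 :=
  h.im_star_dotProduct_mulVec_self v

lemma psd_ker {X : Matrix (Fin n) (Fin n) ℂ} (h : X.PosSemidef) {v} (hv : (qf X v).re = 0) :
    X *ᵥ v = 0 :=
  (h.dotProduct_mulVec_zero_iff v).1 (Complex.ext hv (herm_im h.1 v))

lemma qf_of_ker {X : Matrix (Fin n) (Fin n) ℂ} {v} (hv : X *ᵥ v = 0) : qf X v = 0 := by
  simp [qf, hv]

lemma herm_smul {X : Matrix (Fin n) (Fin n) ℂ} (h : X.IsHermitian) (t : ℝ) :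
    ((t : ℂ) • X).IsHermitian := by
  rw [Matrix.IsHermitian, Matrix.conjTranspose_smul, h.eq]; simp

lemma psd_smul {X : Matrix (Fin n) (Fin n) ℂ} (h : X.PosSemidef) {t : ℝ} (ht : 0 ≤ t) :
    ((t : ℂ) • X).PosSemidef := by
  refine psd_of (herm_smul h.1 t) fun v => ?_
  rw [qf_smul, Complex.re_ofReal_mul]
  exact mul_nonneg ht (psd_re h v)

/-- polarization -/
lemma eq_zero_of_qf {X : Matrix (Fin n) (Fin n) ℂ} (h : ∀ v, qf X v = 0) : X = 0 := by
  have hH : X.PosSemidef := by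
    refine psd_of ?_ fun v => by simp [h v]
    have key : ∀ v w : Fin n → ℂ, star v ⬝ᵥ (X *ᵥ w) = 0 := by
      intro v w
      have e1 := h (v + w)
      have e2 := h (v + Complex.I • w)
      have hv := h v
      have hw := h w
      simp only [qf, star_add, star_smul, Matrix.mulVec_add, Matrix.mulVec_smul, add_dotProduct,
        dotProduct_add, smul_dotProduct, dotProduct_smul, smul_eq_mul] at e1 e2 hv hw
      rw [hv, hw] at e1 e2
      simp only [RCLike.star_def, Complex.conj_I] at e2
      have hI : Complex.I ≠ 0 := Complex.I_ne_zero
      set p := star v ⬝ᵥ (X *ᵥ w)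
      set q := star w ⬝ᵥ (X *ᵥ v)
      have e3 : Complex.I * (p - q) = 0 := by linear_combination e2
      have e4 : p - q = 0 := by simpa [hI] using e3
      linear_combination (e1 + e4) / 2
    have : X = 0 := by
      ext i j
      have := key (Pi.single i 1) (Pi.single j 1)
      simpa using this
    rw [this]; exact Matrix.isHermitian_zero
  have : ∀ v, X *ᵥ v = 0 := fun v => psd_ker hH (by simp [h v])
  ext i j
  have := congrFun (this (Pi.single j 1)) i
  simpa using this

/-- compactness: ratio of homogeneous functions attains max -/
lemma exists_ratio (hn : 1 ≤ n) (f g : (Fin n → ℂ) → ℝ) (hf : Continuous f) (hg : Continuous g)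
    (hf2 : ∀ (c : ℝ) v, f ((c : ℂ) • v) = c ^ 2 * f v)
    (hg2 : ∀ (c : ℝ) v, g ((c : ℂ) • v) = c ^ 2 * g v)
    (hpos : ∀ v, v ≠ 0 → 0 < g v) :
    ∃ v, v ≠ 0 ∧ ∃ t, f v = t * g v ∧ ∀ w, f w ≤ t * g w := by
  have : Nonempty (Fin n) := ⟨⟨0, hn⟩⟩
  have hne : (Metric.sphere (0 : Fin n → ℂ) 1).Nonempty :=
    NormedSpace.sphere_nonempty.2 zero_le_one
  have hs0 : ∀ v ∈ Metric.sphere (0 : Fin n → ℂ) 1, v ≠ 0 := by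
    intro v hv h0; simp [h0] at hv
  obtain ⟨v, hv, hmax⟩ := (isCompact_sphere (0 : Fin n → ℂ) 1).exists_isMaxOn hne
    (f := fun v => f v / g v)
    (hf.continuousOn.div hg.continuousOn fun v hv => (hpos v (hs0 v hv)).ne')
  refine ⟨v, hs0 v hv, f v / g v, ?_, ?_⟩
  · rw [div_mul_cancel₀ _ (hpos v (hs0 v hv)).ne']
  · intro w
    by_cases hw : w = 0
    · have h1 := hf2 0 w
      have h2 := hg2 0 w
      subst hw
      simp at h1 h2
      simp [h1, h2]
    · have hnw : ‖w‖ ≠ 0 := norm_ne_zero_iff.2 hw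
      set w' : Fin n → ℂ := ((‖w‖⁻¹ : ℝ) : ℂ) • w with hw'
      have hmem : w' ∈ Metric.sphere (0 : Fin n → ℂ) 1 := by
        simp [hw', norm_smul, hnw]
      have := hmax hmem
      simp only [Set.mem_ofPred_eq] at this
      rw [div_le_iff₀ (hpos w' (hs0 _ hmem)), hw', hf2, hg2] at this
      have hp : 0 < (‖w‖⁻¹) ^ 2 := by positivity
      nlinarith

lemma extremal (hn : 1 ≤ n) {R Y : Matrix (Fin n) (Fin n) ℂ} (hR : R.PosDef) (hY : Y.IsHermitian) :
    ∃ (t : ℝ) (v : Fin n → ℂ), v ≠ 0 ∧ ((t : ℂ) • R - Y).PosSemidef ∧ ((t : ℂ) • R - Y) *ᵥ v = 0 := by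
  have hc : ∀ X : Matrix (Fin n) (Fin n) ℂ, Continuous fun v => (qf X v).re := fun X =>
    Complex.continuous_re.comp (continuous_qf.comp (by fun_prop : Continuous fun v => (X, v)))
  have hh : ∀ (X : Matrix (Fin n) (Fin n) ℂ) (c : ℝ) v,
      (qf X ((c : ℂ) • v)).re = c ^ 2 * (qf X v).re := by
    intro X c v
    rw [qf_smul_vec]
    simp [pow_two, ← Complex.ofReal_mul]
  obtain ⟨v, hv, t, h1, h2⟩ := exists_ratio hn (fun v => (qf Y v).re) (fun v => (qf R v).re)
    (hc Y) (hc R) (hh Y) (hh R) (fun v hv => pd_re hR hv)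
  have hp : ((t : ℂ) • R - Y).PosSemidef := by
    refine psd_of ((herm_smul hR.1 t).sub hY) fun w => ?_
    rw [qf_sub, qf_smul, Complex.sub_re, Complex.re_ofReal_mul]
    linarith [h2 w]
  refine ⟨t, v, hv, hp, psd_ker hp ?_⟩
  rw [qf_sub, qf_smul, Complex.sub_re, Complex.re_ofReal_mul]
  linarith

/-- The operator. -/
def Lm (D₀ : Matrix (Fin n) (Fin n) ℂ) (D : Fin k → Matrix (Fin n) (Fin n) ℂ) (a : Fin k → ℝ) :
    Matrix (Fin n) (Fin n) ℂ →ₗ[ℂ] Matrix (Fin n) (Fin n) ℂ where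
  toFun X := D₀ * X + X * D₀ᴴ + ∑ r, (a r : ℂ) • (D r * X * (D r)ᴴ)
  map_add' X Y := by
    simp only [mul_add, add_mul, smul_add, Finset.sum_add_distrib]; abel
  map_smul' c X := by
    simp only [mul_smul_comm, smul_mul_assoc, smul_add, Finset.smul_sum, RingHom.id_apply]
    simp only [smul_comm c]

variable {D₀ : Matrix (Fin n) (Fin n) ℂ} {D : Fin k → Matrix (Fin n) (Fin n) ℂ} {a : Fin k → ℝ}

lemma Lm_apply (X) : Lm D₀ D a X = D₀ * X + X * D₀ᴴ + ∑ r, (a r : ℂ) • (D r * X * (D r)ᴴ) := rfl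

lemma Lm_conj (X) : Lm D₀ D a Xᴴ = (Lm D₀ D a X)ᴴ := by
  simp only [Lm_apply, Matrix.conjTranspose_add, Matrix.conjTranspose_mul,
    Matrix.conjTranspose_sum, Matrix.conjTranspose_smul, Matrix.conjTranspose_conjTranspose]
  rw [add_comm (D₀ * Xᴴ)]
  simp [mul_assoc]

lemma Lm_herm {X} (h : X.IsHermitian) : (Lm D₀ D a X).IsHermitian := by
  rw [Matrix.IsHermitian, ← Lm_conj, h.eq]

lemma qf_Lm_ker {Z : Matrix (Fin n) (Fin n) ℂ} (hZ : Z.IsHermitian) {v} (hv : Z *ᵥ v = 0) :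
    qf (Lm D₀ D a Z) v = ∑ r, (a r : ℂ) * qf Z ((D r)ᴴ *ᵥ v) := by
  have hv2 : star v ᵥ* Z = 0 := by
    have := congrArg star hv
    rw [star_mulVec, hZ.eq] at this
    simpa using this
  rw [Lm_apply, qf_add, qf_add, qf_sum]
  have h1 : qf (D₀ * Z) v = 0 := by
    simp [qf, ← Matrix.mulVec_mulVec, hv]
  have h2 : qf (Z * D₀ᴴ) v = 0 := by
    simp [qf, ← Matrix.mulVec_mulVec, Matrix.dotProduct_mulVec, hv2]
  rw [h1, h2, zero_add, zero_add]
  refine Finset.sum_congr rfl fun r _ => ?_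
  rw [qf_smul]
  congr 1
  simp [qf, ← Matrix.mulVec_mulVec, Matrix.dotProduct_mulVec, star_mulVec]

lemma cross_pos (ha : ∀ r, 0 < a r) {Z : Matrix (Fin n) (Fin n) ℂ} (hZ : Z.PosSemidef) {v}
    (hv : Z *ᵥ v = 0) : 0 ≤ (qf (Lm D₀ D a Z) v).re := by
  rw [qf_Lm_ker hZ.1 hv, Complex.re_sum]
  refine Finset.sum_nonneg fun r _ => ?_
  rw [Complex.re_ofReal_mul]
  exact mul_nonneg (ha r).le (psd_re hZ _)

lemma irr_pos (hirr : KrausIrreducible D) (ha : ∀ r, 0 < a r) {Z : Matrix (Fin n) (Fin n) ℂ}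
    (hZ : Z.PosSemidef) (hZ0 : Z ≠ 0)
    (hk : ∀ v, Z *ᵥ v = 0 → (qf (Lm D₀ D a Z) v).re ≤ 0) : Z.PosDef := by
  have hinv : ∀ v, Z *ᵥ v = 0 → ∀ r, Z *ᵥ ((D r)ᴴ *ᵥ v) = 0 := by
    intro v hv r
    have h0 := le_antisymm (hk v hv) (cross_pos ha hZ hv)
    rw [qf_Lm_ker hZ.1 hv, Complex.re_sum, Finset.sum_eq_zero_iff_of_nonneg] at h0
    · have := h0 r (Finset.mem_univ r)
      rw [Complex.re_ofReal_mul] at this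
      exact psd_ker hZ ((mul_eq_zero.1 this).resolve_left (ha r).ne')
    · intro r _
      rw [Complex.re_ofReal_mul]
      exact mul_nonneg (ha r).le (psd_re hZ _)
  let W : Submodule ℂ (Fin n → ℂ) :=
    { carrier := {w | ∀ v, Z *ᵥ v = 0 → star v ⬝ᵥ w = 0}
      add_mem' := by
        intro x y hx hy v hv
        rw [dotProduct_add, hx v hv, hy v hv, add_zero]
      zero_mem' := by intro v _; simp
      smul_mem' := by
        intro c x hx v hv
        rw [dotProduct_smul, hx v hv, smul_zero] }
  obtain ⟨x, hx⟩ : ∃ x, Z *ᵥ x ≠ 0 := by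
    by_contra! hcon
    apply hZ0
    ext i j
    simpa using congrFun (hcon (Pi.single j 1)) i
  have hW : W = ⊤ := by
    refine hirr (Z *ᵥ x) hx W ?_ ?_
    · intro v hv
      rw [Matrix.dotProduct_mulVec]
      have := congrArg star hv
      rw [star_mulVec, hZ.1.eq] at this
      rw [this]; simp
    · intro r w hw v hv
      have := hw _ (hinv v hv r)
      rwa [star_mulVec, Matrix.conjTranspose_conjTranspose, ← Matrix.dotProduct_mulVec] at this
  refine pd_of hZ.1 fun v hv => ?_
  refine lt_of_le_of_ne (psd_re hZ v) fun h => hv ?_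
  have hz := psd_ker hZ h.symm
  have hvW : v ∈ W := by rw [hW]; trivial
  exact dotProduct_star_self_eq_zero.1 (by simpa [dotProduct_comm] using hvW v hz)

/-- spectral bound -/
lemma re_le (hn : 1 ≤ n) (ha : ∀ r, 0 < a r) {R : Matrix (Fin n) (Fin n) ℂ} (hR : R.PosDef) {s : ℝ}
    (hs : Lm D₀ D a R = (s : ℂ) • R) {X : Matrix (Fin n) (Fin n) ℂ} (hX : X ≠ 0) {z : ℂ}
    (hz : Lm D₀ D a X = z • X) : z.re ≤ s := by
  have hc : ∀ X : Matrix (Fin n) (Fin n) ℂ, Continuous fun v => qf X v := fun X =>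
    continuous_qf.comp (by fun_prop : Continuous fun v => (X, v))
  obtain ⟨v, hv, t, h1, h2⟩ := exists_ratio hn (fun v => ‖qf X v‖) (fun v => (qf R v).re)
    (hc X).norm (Complex.continuous_re.comp (hc R))
    (by intro c v; rw [qf_smul_vec]; simp [pow_two])
    (by intro c v; rw [qf_smul_vec]; simp [pow_two, ← Complex.ofReal_mul])
    (fun v hv => pd_re hR hv)
  have hRv := pd_re hR hv
  have ht : 0 < t := by
    by_contra! hle
    apply hX
    refine eq_zero_of_qf fun w => ?_
    by_cases hw : w = 0
    · simp [hw, qf]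
    have := h2 w
    have h3 := pd_re hR hw
    have : ‖qf X w‖ ≤ 0 := by nlinarith
    simpa using this
  -- rotate
  have hne : qf X v ≠ 0 := by
    intro h0; simp only [h0, norm_zero] at h1; nlinarith
  set c : ℂ := (‖qf X v‖ : ℂ) * (qf X v)⁻¹ with hcdef
  have hcn : ‖c‖ = 1 := by
    simp [hcdef, hne]
  have hcv : c * qf X v = (‖qf X v‖ : ℂ) := by
    rw [hcdef, mul_assoc, inv_mul_cancel₀ hne, mul_one]
  set Y : Matrix (Fin n) (Fin n) ℂ := (2⁻¹ : ℂ) • (c • X + (c • X)ᴴ) with hYdef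
  have hYH : Y.IsHermitian := by
    rw [hYdef, Matrix.IsHermitian, Matrix.conjTranspose_smul, Matrix.conjTranspose_add,
      Matrix.conjTranspose_conjTranspose, add_comm]
    simp
  have hre : ∀ (A : Matrix (Fin n) (Fin n) ℂ) (w), (qf ((2⁻¹ : ℂ) • (A + Aᴴ)) w).re = (qf A w).re := by
    intro A w
    rw [qf_smul, qf_add, qf_conj]
    have : (2⁻¹ : ℂ) = ((2⁻¹ : ℝ) : ℂ) := by simp
    rw [this, Complex.re_ofReal_mul]
    simp
    ring
  have hYq : ∀ w, (qf Y w).re = (c * qf X w).re := by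
    intro w
    rw [hYdef, hre, qf_smul]
  have hLY : (qf (Lm D₀ D a Y) v).re = z.re * ‖qf X v‖ := by
    rw [hYdef, map_smul, map_add, Lm_conj, hre, map_smul, hz, qf_smul, qf_smul]
    rw [mul_left_comm, hcv]
    simp
  have hp : ((t : ℂ) • R - Y).PosSemidef := by
    refine psd_of ((herm_smul hR.1 t).sub hYH) fun w => ?_
    rw [qf_sub, qf_smul, Complex.sub_re, Complex.re_ofReal_mul, hYq]
    have h3 := Complex.re_le_norm (c * qf X w)
    rw [norm_mul, hcn, one_mul] at h3
    linarith [h2 w]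
  have hk : ((t : ℂ) • R - Y) *ᵥ v = 0 := by
    refine psd_ker hp ?_
    rw [qf_sub, qf_smul, Complex.sub_re, Complex.re_ofReal_mul, hYq, hcv, Complex.ofReal_re]
    linarith
  have := cross_pos (D₀ := D₀) (D := D) ha hp hk
  rw [map_sub, map_smul, hs, qf_sub, qf_smul, qf_smul, Complex.sub_re, Complex.re_ofReal_mul,
    Complex.re_ofReal_mul, hLY] at this
  rw [h1] at this
  have h5 : 0 < t * (qf R v).re := mul_pos ht hRv
  nlinarith

/-- simplicity, part 1 -/
lemma ker_simple (hn : 1 ≤ n) (hirr : KrausIrreducible D) (ha : ∀ r, 0 < a r)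
    {R : Matrix (Fin n) (Fin n) ℂ} (hR : R.PosDef) {s : ℝ}
    (hs : Lm D₀ D a R = (s : ℂ) • R) {Y : Matrix (Fin n) (Fin n) ℂ} (hY : Y.IsHermitian)
    (hz : Lm D₀ D a Y = (s : ℂ) • Y) : ∃ t : ℝ, Y = (t : ℂ) • R := by
  obtain ⟨t, v, hv, hp, hk⟩ := extremal hn hR hY
  refine ⟨t, ?_⟩
  by_contra hne
  have hZ : (t : ℂ) • R - Y ≠ 0 := fun h => hne (sub_eq_zero.1 h).symm
  have hL : Lm D₀ D a ((t : ℂ) • R - Y) = (s : ℂ) • ((t : ℂ) • R - Y) := by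
    rw [map_sub, map_smul, hs, hz, smul_sub, smul_comm]
  have hpd := irr_pos (D₀ := D₀) hirr ha hp hZ (by
    intro w hw
    rw [hL, qf_smul, qf_of_ker hw]; simp)
  have := pd_re hpd hv
  rw [qf_of_ker hk] at this
  simp at this

/-- simplicity, part 2 -/
lemma not_range (hn : 1 ≤ n) (ha : ∀ r, 0 < a r)
    {R : Matrix (Fin n) (Fin n) ℂ} (hR : R.PosDef) {s : ℝ}
    (hs : Lm D₀ D a R = (s : ℂ) • R) {Y : Matrix (Fin n) (Fin n) ℂ} (hY : Y.IsHermitian)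
    {b : ℝ} (hz : Lm D₀ D a Y = (s : ℂ) • Y + (b : ℂ) • R) : b ≤ 0 := by
  obtain ⟨t, v, hv, hp, hk⟩ := extremal hn hR hY
  have hL : Lm D₀ D a ((t : ℂ) • R - Y) = (s : ℂ) • ((t : ℂ) • R - Y) - (b : ℂ) • R := by
    rw [map_sub, map_smul, hs, hz, smul_sub, smul_comm]; abel
  have := cross_pos (D₀ := D₀) (D := D) ha hp hk
  rw [hL, qf_sub, qf_smul, qf_smul, qf_of_ker hk, mul_zero, zero_sub, Complex.neg_re,
    Complex.re_ofReal_mul] at this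
  have h2 := pd_re hR hv
  nlinarith

lemma one_pd : (1 : Matrix (Fin n) (Fin n) ℂ).PosDef := Matrix.PosDef.one

/-- maximum principle -/
lemma max_principle (hn : 1 ≤ n) (ha : ∀ r, 0 < a r) {c : ℝ}
    (hc : ((c : ℂ) • 1 - Lm D₀ D a 1).PosDef) {y : Matrix (Fin n) (Fin n) ℂ} (hy : y.IsHermitian)
    (hx : ((c : ℂ) • y - Lm D₀ D a y).PosSemidef) : y.PosSemidef := by
  obtain ⟨t, v, hv, hp, hk⟩ := extremal hn one_pd hy.neg
  rw [sub_neg_eq_add] at hp hk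
  have ht : t ≤ 0 := by
    by_contra! htpos
    have h1 := cross_pos (D₀ := D₀) (D := D) ha hp hk
    have h2 := psd_re hx v
    have h3 := pd_re hc hv
    have h4 := congrArg Complex.re (qf_of_ker hk)
    rw [qf_add, qf_smul, Complex.add_re, Complex.re_ofReal_mul] at h4
    rw [map_add, map_smul, qf_add, qf_smul, Complex.add_re, Complex.re_ofReal_mul] at h1
    rw [qf_sub, qf_smul, Complex.sub_re, Complex.re_ofReal_mul] at h2 h3
    rw [Complex.zero_re] at h4
    have h5 := mul_pos htpos h3
    have h6 : c * (t * (qf 1 v).re + (qf y v).re) = 0 := by rw [h4, mul_zero]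
    nlinarith
  have := hp.add (psd_smul (one_pd (n := n)).posSemidef (neg_nonneg.2 ht))
  convert this using 1
  simp [← sub_eq_add_neg]

lemma psd_antisymm {X : Matrix (Fin n) (Fin n) ℂ} (h : X.PosSemidef) (h' : (-X).PosSemidef) :
    X = 0 := by
  refine eq_zero_of_qf fun v => Complex.ext ?_ (herm_im h.1 v)
  have h1 := psd_re h v
  have h2 := psd_re h' v
  rw [qf_neg, Complex.neg_re] at h2
  simp; linarith

abbrev Hm (n : ℕ) := selfAdjoint.submodule ℝ (Matrix (Fin n) (Fin n) ℂ)

lemma Hm_herm (X : Hm n) : (X : Matrix (Fin n) (Fin n) ℂ).IsHermitian := X.2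

lemma coe_smul' (t : ℝ) (X : Matrix (Fin n) (Fin n) ℂ) : t • X = (t : ℂ) • X := by
  ext i j; simp

/-- restricted operator -/
def Lr (D₀ : Matrix (Fin n) (Fin n) ℂ) (D : Fin k → Matrix (Fin n) (Fin n) ℂ) (a : Fin k → ℝ) :
    Hm n →ₗ[ℝ] Hm n where
  toFun X := ⟨Lm D₀ D a X, Lm_herm (Hm_herm X)⟩
  map_add' X Y := by ext1; simp
  map_smul' c X := by ext1; simp [-Complex.coe_smul, coe_smul']

lemma Lr_coe (X : Hm n) : ((Lr D₀ D a X : Hm n) : Matrix (Fin n) (Fin n) ℂ) = Lm D₀ D a X := rfl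

lemma exists_c (hn : 1 ≤ n) :
    ∃ c : ℝ, ((c : ℂ) • 1 - Lm D₀ D a 1).PosDef := by
  obtain ⟨t, v, hv, hp, hk⟩ := extremal hn (one_pd (n := n))
    (Lm_herm (D₀ := D₀) (D := D) (a := a) (one_pd (n := n)).1)
  refine ⟨t + 1, ?_⟩
  have := (one_pd (n := n)).add_posSemidef hp
  convert this using 1
  push_cast
  rw [add_smul, one_smul]; abel

lemma resolvent (hn : 1 ≤ n) (ha : ∀ r, 0 < a r) {c : ℝ}
    (hc : ((c : ℂ) • 1 - Lm D₀ D a 1).PosDef) {x : Matrix (Fin n) (Fin n) ℂ} (hx : x.IsHermitian) :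
    ∃ y : Matrix (Fin n) (Fin n) ℂ, y.IsHermitian ∧ (c : ℂ) • y - Lm D₀ D a y = x := by
  let T : Hm n →ₗ[ℝ] Hm n := c • LinearMap.id - Lr D₀ D a
  have hT : ∀ y : Hm n, ((T y : Hm n) : Matrix (Fin n) (Fin n) ℂ) = (c : ℂ) • (y : Matrix (Fin n) (Fin n) ℂ)
      - Lm D₀ D a y := by
    intro y; simp [-Complex.coe_smul, T, Lr_coe, coe_smul']
  have hinj : Function.Injective T := by
    rw [injective_iff_map_eq_zero]
    intro y hy
    have h0 : (c : ℂ) • (y : Matrix (Fin n) (Fin n) ℂ) - Lm D₀ D a y = 0 := by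
      rw [← hT, hy]; rfl
    ext1
    refine psd_antisymm (max_principle hn ha hc (Hm_herm y) (by rw [h0]; exact .zero))
      (max_principle hn ha hc (Hm_herm y).neg ?_)
    have : (c : ℂ) • (-(y : Matrix (Fin n) (Fin n) ℂ)) - Lm D₀ D a (-(y : Matrix (Fin n) (Fin n) ℂ)) = 0 := by
      rw [map_neg, smul_neg, ← neg_eq_zero, ← h0]; abel
    rw [this]; exact .zero
  obtain ⟨y, hy⟩ := LinearMap.injective_iff_surjective.1 hinj ⟨x, hx⟩
  exact ⟨y, Hm_herm y, by rw [← hT, hy]⟩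

lemma isClosed_psd : IsClosed {X : Matrix (Fin n) (Fin n) ℂ | X.PosSemidef} := by
  have : {X : Matrix (Fin n) (Fin n) ℂ | X.PosSemidef} =
      {X | Xᴴ = X} ∩ ⋂ v, {X | 0 ≤ (qf X v).re} := by
    ext X
    simp only [Set.mem_ofPred_eq, Set.mem_inter_iff, Set.mem_iInter]
    exact ⟨fun h => ⟨h.1, psd_re h⟩, fun h => psd_of h.1 h.2⟩
  rw [this]
  refine IsClosed.inter (isClosed_eq (by fun_prop) continuous_id) (isClosed_iInter fun v => ?_)
  exact isClosed_le continuous_const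
    (Complex.continuous_re.comp (continuous_qf.comp (by fun_prop : Continuous fun X => (X, v))))

/-- Perron–Frobenius existence -/
lemma exists_perron (hn : 1 ≤ n) (hirr : KrausIrreducible D) (ha : ∀ r, 0 < a r) :
    ∃ (s : ℝ) (R : Matrix (Fin n) (Fin n) ℂ), R.PosDef ∧ Lm D₀ D a R = (s : ℂ) • R := by
  have : Nonempty (Fin n) := ⟨⟨0, hn⟩⟩
  obtain ⟨c, hc⟩ := exists_c (D₀ := D₀) (D := D) (a := a) hn
  -- lower bound
  obtain ⟨t, v, hv, hp, hk⟩ := extremal hn (one_pd (n := n))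
    (Lm_herm (D₀ := D₀) (D := D) (a := a) (one_pd (n := n)).1).neg
  have hfd : FiniteDimensional ℝ (Matrix (Fin n) (Fin n) ℂ) := inferInstance
  have : ProperSpace (Matrix (Fin n) (Fin n) ℂ) := FiniteDimensional.proper ℝ _
  have hLc : Continuous (Lm D₀ D a) := LinearMap.continuous_of_finiteDimensional _
  let F : Matrix (Fin n) (Fin n) ℂ × ℝ → Prop := fun p =>
    p.1.PosSemidef ∧ (Lm D₀ D a p.1 - (p.2 : ℂ) • p.1).PosSemidef
  have hupper : ∀ p, F p → p.1 ≠ 0 → p.2 ≤ c := by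
    intro p hF hne
    by_contra! hlt
    have h1 := max_principle hn ha hc hF.1.1.neg (by
      have := hF.2.add (psd_smul hF.1 (sub_nonneg.2 hlt.le))
      convert this using 1
      rw [map_neg]; push_cast; rw [sub_smul, smul_neg]; abel)
    exact hne (psd_antisymm hF.1 h1)
  let S : Set (Matrix (Fin n) (Fin n) ℂ × ℝ) :=
    (Metric.sphere 0 1 ×ˢ Set.Icc (-t) c) ∩ {p | F p}
  have hScomp : IsCompact S := by
    refine ((isCompact_sphere 0 1).prod isCompact_Icc).inter_right ?_
    refine IsClosed.inter (isClosed_psd.preimage continuous_fst) (isClosed_psd.preimage ?_)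
    exact (hLc.comp continuous_fst).sub
      ((Complex.continuous_ofReal.comp continuous_snd).smul continuous_fst)
  have hscale : ∀ p, F p → p.1 ≠ 0 → -t ≤ p.2 →
      ((((‖p.1‖⁻¹ : ℝ) : ℂ) • p.1, p.2) : Matrix (Fin n) (Fin n) ℂ × ℝ) ∈ S := by
    intro p hF hne hle
    have hnn : ‖p.1‖ ≠ 0 := norm_ne_zero_iff.2 hne
    refine ⟨⟨?_, hle, hupper p hF hne⟩, psd_smul hF.1 (by positivity), ?_⟩
    · simp [norm_smul, hnn]
    · have := psd_smul hF.2 (t := ‖p.1‖⁻¹) (by positivity)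
      convert this using 1
      simp only [map_smul, smul_sub]
      rw [smul_comm]
  have hSne : S.Nonempty := by
    refine ⟨_, hscale (1, -t) ⟨one_pd.posSemidef, ?_⟩ one_ne_zero le_rfl⟩
    convert hp using 1
    push_cast
    rw [neg_smul]; abel
  obtain ⟨⟨ρ, s⟩, hmem, hmax⟩ := hScomp.exists_isMaxOn hSne (f := Prod.snd) continuous_snd.continuousOn
  have hF : F (ρ, s) := hmem.2
  have hρ0 : ρ ≠ 0 := by
    rintro rfl
    have := hmem.1.1
    simp at this
  have hst : -t ≤ s := hmem.1.2.1
  by_cases hx0 : Lm D₀ D a ρ - (s : ℂ) • ρ = 0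
  · have hE : Lm D₀ D a ρ = (s : ℂ) • ρ := sub_eq_zero.1 hx0
    refine ⟨s, ρ, irr_pos (D₀ := D₀) hirr ha hF.1 hρ0 ?_, hE⟩
    intro v hv
    rw [hE, qf_smul, qf_of_ker hv]; simp
  exfalso
  -- the resolvent is positivity improving
  have himp : ∀ x y : Matrix (Fin n) (Fin n) ℂ, x.PosSemidef → x ≠ 0 → y.IsHermitian →
      (c : ℂ) • y - Lm D₀ D a y = x → y.PosDef := by
    intro x y hx hx0 hy hxy
    have hyp : y.PosSemidef := max_principle hn ha hc hy (by rw [hxy]; exact hx)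
    refine irr_pos (D₀ := D₀) hirr ha hyp ?_ ?_
    · rintro rfl
      apply hx0; rw [← hxy]; simp
    · intro v hv
      have h1 := psd_re hx v
      rw [← hxy, qf_sub, qf_smul, qf_of_ker hv] at h1
      simpa using h1
  obtain ⟨y, hyH, hy⟩ := resolvent (D₀ := D₀) (D := D) hn ha hc hF.1.1
  have hy' : (c : ℂ) • y - Lm D₀ D a y = ρ := hy
  have hypd := himp ρ y hF.1 hρ0 hyH hy
  set w := Lm D₀ D a y - (s : ℂ) • y with hw
  have hwpd : w.PosDef := by
    refine himp _ w hF.2 hx0 ((Lm_herm hyH).sub (herm_smul hyH s)) ?_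
    rw [hw]
    rw [← hy']
    simp only [map_sub, map_smul, smul_sub]
    rw [smul_comm (c : ℂ) (s : ℂ)]; abel
  obtain ⟨q, v', hv', hq, -⟩ := extremal hn hwpd hyH
  set q' := max q 1 with hq'
  have hq1 : 0 < q' := lt_of_lt_of_le one_pos (le_max_right _ _)
  have hq2 : ((q' : ℂ) • w - y).PosSemidef := by
    have := hq.add (psd_smul hwpd.posSemidef (sub_nonneg.2 (le_max_left q 1)))
    convert this using 1
    push_cast
    rw [sub_smul]; abel
  have hFy : F (y, s + q'⁻¹) := by
    refine ⟨hypd.posSemidef, ?_⟩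
    have := psd_smul hq2 (t := q'⁻¹) (by positivity)
    convert this using 1
    rw [smul_sub, smul_smul]
    have : ((q'⁻¹ : ℝ) : ℂ) * (q' : ℂ) = 1 := by
      rw [← Complex.ofReal_mul, inv_mul_cancel₀ hq1.ne', Complex.ofReal_one]
    rw [this, one_smul, hw]
    push_cast
    rw [add_smul]; abel
  have hy0 : y ≠ 0 := by
    rintro rfl
    apply hρ0; rw [← hy']; simp
  have hpos : 0 < q'⁻¹ := by positivity
  have := hmax (hscale _ hFy hy0 (by simp only; linarith))
  simp at this
  linarith

/-- positive definite is an open condition among hermitian matrices -/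
lemma pd_open (R : Hm n) (hR : (R : Matrix (Fin n) (Fin n) ℂ).PosDef) :
    ∀ᶠ Y : Hm n in nhds R, (Y : Matrix (Fin n) (Fin n) ℂ).PosDef := by
  have h := (isCompact_sphere (0 : Fin n → ℂ) 1).eventually_forall_of_forall_eventually (x₀ := R)
    (P := fun Y v => 0 < (qf (Y : Matrix (Fin n) (Fin n) ℂ) v).re) (by
      intro v hv
      have hv0 : v ≠ 0 := by rintro rfl; simp at hv
      have hcont : Continuous fun z : Hm n × (Fin n → ℂ) =>
          (qf (z.1 : Matrix (Fin n) (Fin n) ℂ) z.2).re :=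
        Complex.continuous_re.comp (continuous_qf.comp
          ((continuous_subtype_val.comp continuous_fst).prodMk continuous_snd))
      exact hcont.continuousAt.eventually (lt_mem_nhds (pd_re hR hv0)))
  filter_upwards [h] with Y hY
  refine pd_of (Hm_herm Y) fun w hw => ?_
  have hnw : 0 < ‖w‖ := norm_pos_iff.2 hw
  have := hY (((‖w‖⁻¹ : ℝ) : ℂ) • w) (by simp [norm_smul, hnw.ne'])
  rw [qf_smul_vec] at this
  simp only [RCLike.star_def, Complex.conj_ofReal, ← Complex.ofReal_mul, Complex.re_ofReal_mul] at this
  exact (pos_iff_pos_of_mul_pos this).1 (by positivity)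

/-- real trace -/
def trr (n : ℕ) : Hm n →ₗ[ℝ] ℝ where
  toFun X := (Matrix.trace (X : Matrix (Fin n) (Fin n) ℂ)).re
  map_add' X Y := by simp
  map_smul' c X := by simp

lemma Lr_decomp (X : Hm n) :
    Lr D₀ D a X = Lr D₀ D 0 X + ∑ r, a r • Lr 0 D (Pi.single r 1) X := by
  ext1
  have h : ∀ r, Lm 0 D (Pi.single r 1) (X : Matrix (Fin n) (Fin n) ℂ)
      = D r * (X : Matrix (Fin n) (Fin n) ℂ) * (D r)ᴴ := by
    intro r
    rw [Lm_apply, Finset.sum_eq_single r]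
    · simp
    · intro b _ hb; simp [hb]
    · simp
  rw [Submodule.coe_add, Submodule.coe_sum]
  simp only [Submodule.coe_smul, Lr_coe, h, coe_smul']
  simp [Lm_apply]

lemma local_branch {E : Type*} [NormedAddCommGroup E] [NormedSpace ℝ E] [CompleteSpace E]
    (hn : 1 ≤ n) (hirr : KrausIrreducible D) (α : E → Fin k → ℝ) (hα : ContDiff ℝ ⊤ α)
    (hpos : ∀ u r, 0 < α u r) (u₀ : E) :
    ∃ g : E → ℝ, AnalyticAt ℝ g u₀ ∧ ∀ᶠ u in nhds u₀,
      ∃ R : Matrix (Fin n) (Fin n) ℂ, R.PosDef ∧ Lm D₀ D (α u) R = (g u : ℂ) • R := by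
  have : Nonempty (Fin n) := ⟨⟨0, hn⟩⟩
  obtain ⟨s, R, hR, hs⟩ := exists_perron (D₀ := D₀) hn hirr (hpos u₀)
  let R' : Hm n := ⟨R, hR.1⟩
  let C (f : Hm n →ₗ[ℝ] Hm n) : Hm n →L[ℝ] Hm n := LinearMap.toContinuousLinearMap f
  let tc : Hm n →L[ℝ] ℝ := LinearMap.toContinuousLinearMap (trr n)
  let F : E × (Hm n × ℝ) → Hm n × ℝ := fun p =>
    (C (Lr D₀ D 0) p.2.1 + ∑ r, α p.1 r • C (Lr 0 D (Pi.single r 1)) p.2.1 - p.2.2 • p.2.1,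
      tc p.2.1)
  have hFeq : ∀ u X l, F (u, (X, l)) = (Lr D₀ D (α u) X - l • X, trr n X) := by
    intro u X l
    rw [Lr_decomp]; rfl
  have hα' : ∀ r, ContDiff ℝ ⊤ (fun p : E × (Hm n × ℝ) => α p.1 r) := fun r =>
    (contDiff_pi.1 hα r).comp contDiff_fst
  have h21 : ContDiff ℝ ⊤ (fun p : E × (Hm n × ℝ) => p.2.1) := contDiff_fst.comp contDiff_snd
  have h22 : ContDiff ℝ ⊤ (fun p : E × (Hm n × ℝ) => p.2.2) := contDiff_snd.comp contDiff_snd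
  have hF : ContDiff ℝ ⊤ F := by
    refine ContDiff.prodMk ?_ (tc.contDiff.comp h21)
    refine ContDiff.sub (ContDiff.add ((C (Lr D₀ D 0)).contDiff.comp h21) ?_) (h22.smul h21)
    exact ContDiff.sum fun r _ => (hα' r).smul ((C (Lr 0 D (Pi.single r 1))).contDiff.comp h21)
  let y₀ : Hm n × ℝ := (R', s)
  let A : (Hm n × ℝ) →ₗ[ℝ] (Hm n × ℝ) :=
    LinearMap.prod ((Lr D₀ D (α u₀)).comp (LinearMap.fst ℝ _ _) - s • (LinearMap.fst ℝ (Hm n) ℝ)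
      - (LinearMap.snd ℝ (Hm n) ℝ).smulRight R') ((trr n).comp (LinearMap.fst ℝ _ _))
  have hA : ∀ X l, A (X, l) = (Lr D₀ D (α u₀) X - s • X - l • R', trr n X) := fun X l => rfl
  have hAinj : Function.Injective A := by
    rw [injective_iff_map_eq_zero]
    rintro ⟨X, l⟩ h
    rw [hA, Prod.mk_eq_zero] at h
    obtain ⟨h1, h2⟩ := h
    have h3 := congrArg (Subtype.val) h1
    have h4 : Lm D₀ D (α u₀) X = (s : ℂ) • (X : Matrix (Fin n) (Fin n) ℂ) + (l : ℂ) • R := by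
      have : Lm D₀ D (α u₀) X - s • (X : Matrix (Fin n) (Fin n) ℂ) - l • R = 0 := h3
      rw [coe_smul', coe_smul', sub_sub, sub_eq_zero] at this
      exact this
    have hl1 := not_range hn (hpos u₀) hR hs (Hm_herm X) h4
    have hl2 := not_range hn (hpos u₀) hR hs (Hm_herm X).neg (b := -l) (by
      rw [map_neg, h4]; push_cast; rw [smul_neg, neg_smul]; abel)
    have hl : l = 0 := by linarith
    subst hl
    obtain ⟨t, ht⟩ := ker_simple hn hirr (hpos u₀) hR hs (Hm_herm X) (by simpa using h4)
    have h5 : (Matrix.trace (X : Matrix (Fin n) (Fin n) ℂ)).re = 0 := h2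
    rw [ht, Matrix.trace_smul, smul_eq_mul, Complex.re_ofReal_mul] at h5
    have h6 := (Complex.lt_def.1 hR.trace_pos).1
    have ht0 : t = 0 := (mul_eq_zero.1 h5).resolve_right h6.ne'
    rw [Prod.mk_eq_zero]
    refine ⟨?_, rfl⟩
    ext1
    rw [ht, ht0]; simp
  let e : (Hm n × ℝ) ≃L[ℝ] (Hm n × ℝ) := (LinearEquiv.ofInjectiveEndo A hAinj).toContinuousLinearEquiv
  have hderiv : fderiv ℝ F (u₀, y₀) ∘L .inr ℝ E (Hm n × ℝ) = (e : (Hm n × ℝ) →L[ℝ] (Hm n × ℝ)) := by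
    have hd : HasFDerivAt F (fderiv ℝ F (u₀, y₀)) (u₀, y₀) :=
      (hF.differentiable (by simp)).differentiableAt.hasFDerivAt
    have h1 : HasFDerivAt (fun y => F (u₀, y)) (fderiv ℝ F (u₀, y₀) ∘L .inr ℝ E (Hm n × ℝ)) y₀ :=
      HasFDerivAt.comp y₀ hd (hasFDerivAt_prodMk_right u₀ y₀)
    have h2 : HasFDerivAt (fun y : Hm n × ℝ => F (u₀, y)) (e : (Hm n × ℝ) →L[ℝ] (Hm n × ℝ)) y₀ := by
      have e1 : (fun y : Hm n × ℝ => F (u₀, y)) =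
          fun y => (C (Lr D₀ D (α u₀)) y.1 - y.2 • y.1, tc y.1) := by
        funext y; exact hFeq u₀ y.1 y.2
      rw [e1]
      have hf : HasFDerivAt (fun y : Hm n × ℝ => y.1) (ContinuousLinearMap.fst ℝ (Hm n) ℝ) y₀ :=
        hasFDerivAt_fst
      have hsn : HasFDerivAt (fun y : Hm n × ℝ => y.2) (ContinuousLinearMap.snd ℝ (Hm n) ℝ) y₀ :=
        hasFDerivAt_snd
      have := (((C (Lr D₀ D (α u₀))).hasFDerivAt.comp y₀ hf).sub (hsn.smul hf)).prodMk
        (tc.hasFDerivAt.comp y₀ hf)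
      refine this.congr_fderiv (ContinuousLinearMap.ext fun ⟨X, l⟩ => ?_)
      symm
      change A (X, l) = (C (Lr D₀ D (α u₀)) X - (s • X + l • R'), tc X)
      rw [hA, sub_sub]; rfl
    exact h1.unique h2
  have hinv : (fderiv ℝ F (u₀, y₀) ∘L .inr ℝ E (Hm n × ℝ)).IsInvertible := ⟨e, hderiv.symm⟩
  have cdf : ContDiffAt ℝ ⊤ F (u₀, y₀) := hF.contDiffAt
  have pn : (⊤ : WithTop ℕ∞) ≠ 0 := by simp
  let ψ := cdf.implicitFunction pn hinv
  have hψ : ContDiffAt ℝ ⊤ ψ u₀ := cdf.contDiffAt_implicitFunction pn hinv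
  have hψ0 : ψ u₀ = y₀ := cdf.implicitFunction_apply_self pn hinv
  have hev : ∀ᶠ u in nhds u₀, F (u, ψ u) = F (u₀, y₀) := cdf.eventually_apply_implicitFunction pn hinv
  refine ⟨fun u => (ψ u).2, ?_, ?_⟩
  · have : ContDiffAt ℝ ⊤ (fun u => (ψ u).2) u₀ := contDiffAt_snd.comp u₀ hψ
    exact this.analyticAt
  · have hc1 : Filter.Tendsto (fun u => (ψ u).1) (nhds u₀) (nhds R') := by
      have := (continuous_fst.continuousAt.comp hψ.continuousAt).tendsto
      rw [Function.comp_apply, hψ0] at this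
      exact this
    have h0 : (F (u₀, y₀)).1 = 0 := by
      rw [hFeq]
      ext1
      change Lm D₀ D (α u₀) R - s • R = 0
      rw [hs, coe_smul', sub_self]
    filter_upwards [hev, hc1.eventually (pd_open R' hR)] with u hu1 hu2
    refine ⟨_, hu2, ?_⟩
    have h3 : (F (u, ((ψ u).1, (ψ u).2))).1 = 0 := by rw [← h0, ← hu1]
    rw [hFeq] at h3
    have h4 := congrArg Subtype.val h3
    have h5 : Lm D₀ D (α u) ((ψ u).1 : Matrix (Fin n) (Fin n) ℂ)
      - (ψ u).2 • ((ψ u).1 : Matrix (Fin n) (Fin n) ℂ) = 0 := h4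
    rw [coe_smul', sub_eq_zero] at h5
    exact h5

lemma mem_spec {E : Type*} [AddCommGroup E] [Module ℂ E] [TopologicalSpace E]
    [IsTopologicalAddGroup E] [ContinuousSMul ℂ E] [T2Space E] [FiniteDimensional ℂ E]
    (T : E →L[ℂ] E) (z : ℂ) : z ∈ spectrum ℂ T ↔ ∃ X, X ≠ 0 ∧ T X = z • X := by
  rw [spectrum.mem_iff]
  have happ : ∀ X, (algebraMap ℂ (E →L[ℂ] E) z - T) X = z • X - T X := by
    intro X
    simp [Algebra.algebraMap_eq_smul_one]
  constructor
  · intro h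
    by_contra! hcon
    apply h
    have hinj : Function.Injective
        ((algebraMap ℂ (E →L[ℂ] E) z - T : E →L[ℂ] E) : E →ₗ[ℂ] E) := by
      rw [injective_iff_map_eq_zero]
      intro X hX
      by_contra h0
      refine hcon X h0 ?_
      have hX' : (algebraMap ℂ (E →L[ℂ] E) z - T) X = 0 := hX
      rw [happ, sub_eq_zero] at hX'
      exact hX'.symm
    let e : E ≃L[ℂ] E := (LinearEquiv.ofInjectiveEndo _ hinj).toContinuousLinearEquiv
    exact ⟨ContinuousLinearEquiv.toUnit e, by ext1 X; rfl⟩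
  · rintro ⟨X, hX, h⟩ ⟨U, hU⟩
    apply hX
    have h1 : (U : E →L[ℂ] E) X = 0 := by rw [hU, happ, h, sub_self]
    have h2 : ((↑U⁻¹ : E →L[ℂ] E) * (U : E →L[ℂ] E)) X = 0 := by
      rw [mul_apply_eq_comp, h1, map_zero]
    rw [Units.inv_mul] at h2
    exact h2

end PF

theorem stmt_10 (n d : ℕ) (hn : 1 ≤ n) (hd : 1 ≤ d)
    (D : Fin (2 * d) → Matrix (Fin n) (Fin n) ℂ)
    (H₀ : Matrix (Fin n) (Fin n) ℂ) (hH₀ : H₀.IsHermitian)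
    (D₀ : Matrix (Fin n) (Fin n) ℂ)
    (hD₀ : D₀ = -(Complex.I • H₀) - (2⁻¹ : ℂ) • ∑ r, (D r)ᴴ * D r)
    (hirr : KrausIrreducible D)
    -- the family of deformed Lindblad operators `u ↦ L^(u)`
    (Lop : (Fin d → ℝ) → (Matrix (Fin n) (Fin n) ℂ →L[ℂ] Matrix (Fin n) (Fin n) ℂ))
    (hLop : ∀ u ρ, Lop u ρ = D₀ * ρ + ρ * D₀ᴴ +
      ∑ r, ((Real.exp (∑ j, u j * eVec d r j) : ℝ) : ℂ) • (D r * ρ * (D r)ᴴ))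
    -- `l u` is the maximal real part of the spectrum of `L^(u)`
    (l : (Fin d → ℝ) → ℝ)
    (hl : ∀ u, IsGreatest (Complex.re '' spectrum ℂ (Lop u)) (l u)) :
    AnalyticOnNhd ℝ l Set.univ := by
  intro u₀ _
  let α : (Fin d → ℝ) → Fin (2 * d) → ℝ := fun u r => Real.exp (∑ j, u j * eVec d r j)
  have hα : ContDiff ℝ ⊤ α := by
    refine contDiff_pi.2 fun r => Real.contDiff_exp.comp (ContDiff.sum fun j _ => ?_)
    exact (contDiff_apply ℝ ℝ j).mul contDiff_const
  have hpos : ∀ u r, 0 < α u r := fun u r => Real.exp_pos _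
  have hL : ∀ u ρ, Lop u ρ = PF.Lm D₀ D (α u) ρ := fun u ρ => hLop u ρ
  obtain ⟨g, hg, hev⟩ := PF.local_branch (D₀ := D₀) hn hirr α hα hpos u₀
  refine hg.congr ?_
  filter_upwards [hev] with u ⟨R, hR, hs⟩
  have hspec : ∀ z : ℂ, z ∈ spectrum ℂ (Lop u) ↔ ∃ X, X ≠ 0 ∧ PF.Lm D₀ D (α u) X = z • X := by
    intro z
    rw [PF.mem_spec]
    simp only [hL]
  have hne : R ≠ 0 := by
    rintro rfl
    have : (1 : Fin n → ℂ) ≠ 0 := fun h => by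
      have := congrFun h ⟨0, hn⟩
      simp at this
    have := PF.pd_re hR this
    simp [PF.qf] at this
  apply le_antisymm
  · exact (hl u).2 ⟨(g u : ℂ), (hspec _).2 ⟨R, hne, hs⟩, by simp⟩
  · obtain ⟨z, hz, hzl⟩ := (hl u).1
    obtain ⟨X, hX, hX2⟩ := (hspec z).1 hz
    rw [← hzl]
    exact PF.re_le hn (hpos u) hR hs hX hX2
end
end

section
/- Algebraic simplicity from trace preservation: let T : M_n(ℂ) → M_n(ℂ) be a linear map which is trace-preserving, i.e. Tr(T(X)) = Tr(X) for all X ∈ M_n(ℂ). Suppose that the eigenspace of T for the eigenvalue 1 is one-dimensional and contains a nonzero positive semidefinite matrix X₁. Then the eigenvalue 1 of T is algebraically simple, i.e. the generalized eigenspace of T for the eigenvalue 1 is one-dimensional. -/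
/-!
Statement 11: Algebraic simplicity from trace preservation: if `T : M_n(ℂ) → M_n(ℂ)` is
linear, trace-preserving, and the eigenspace of `T` for the eigenvalue `1` is
one-dimensional and contains a nonzero positive semidefinite matrix `X₁`, then the
generalized eigenspace of `T` for the eigenvalue `1` is one-dimensional.
-/

open Matrix
open scoped ComplexOrder

theorem stmt_11 (n : ℕ)
    (T : Module.End ℂ (Matrix (Fin n) (Fin n) ℂ))
    (htr : ∀ X : Matrix (Fin n) (Fin n) ℂ, (T X).trace = X.trace)
    (heig : Module.finrank ℂ (Module.End.eigenspace T 1) = 1)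
    (X₁ : Matrix (Fin n) (Fin n) ℂ) (hX₁_pos : X₁.PosSemidef) (hX₁_ne : X₁ ≠ 0)
    (hX₁ : T X₁ = X₁) :
    Module.finrank ℂ (Module.End.maxGenEigenspace T 1) = 1 := by
  have hle : Module.End.maxGenEigenspace T 1 = Module.End.eigenspace T 1 := by
    apply le_antisymm _ Module.End.eigenspace_le_maxGenEigenspace
    have htr0 : X₁.trace ≠ 0 := fun h => hX₁_ne (hX₁_pos.trace_eq_zero_iff.mp h)
    have hmem : X₁ ∈ Module.End.eigenspace T 1 := by
      rw [Module.End.mem_eigenspace_iff, hX₁, one_smul]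
    have hspan : ∀ Z : Matrix (Fin n) (Fin n) ℂ, T Z = Z → ∃ c : ℂ, c • X₁ = Z := by
      intro Z hZ
      have hZm : Z ∈ Module.End.eigenspace T 1 := by
        rw [Module.End.mem_eigenspace_iff, hZ, one_smul]
      have hne : (⟨X₁, hmem⟩ : Module.End.eigenspace T 1) ≠ 0 := by
        intro h
        exact hX₁_ne (congrArg Subtype.val h)
      obtain ⟨c, hc⟩ := (finrank_eq_one_iff_of_nonzero' _ hne).mp heig ⟨Z, hZm⟩
      exact ⟨c, congrArg Subtype.val hc⟩
    have key : ∀ (k : ℕ) (Y : Matrix (Fin n) (Fin n) ℂ),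
        ((T - (1 : ℂ) • (1 : Module.End ℂ (Matrix (Fin n) (Fin n) ℂ))) ^ k) Y = 0 → T Y = Y := by
      intro k
      induction k with
      | zero =>
        intro Y hY
        have h0 : Y = 0 := by simpa using hY
        simp [h0]
      | succ k ih =>
        intro Y hY
        rw [pow_succ, Module.End.mul_apply] at hY
        have h1 := ih _ hY
        obtain ⟨c, hc⟩ := hspan _ h1
        have h2 : c • X₁ = T Y - Y := by simpa using hc
        have h3 := congrArg Matrix.trace h2
        rw [Matrix.trace_smul, Matrix.trace_sub, htr, sub_self, smul_eq_mul] at h3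
        have hc0 : c = 0 := (mul_eq_zero.mp h3).resolve_right htr0
        rw [hc0, zero_smul] at h2
        exact sub_eq_zero.mp h2.symm
    intro Y hY
    obtain ⟨k, hk⟩ := (Module.End.mem_maxGenEigenspace T 1 Y).mp hY
    rw [Module.End.mem_eigenspace_iff, one_smul]
    exact key k Y hk
  rw [hle]
  exact heig
end

section
/- Second example on ℤ: let n = 2, d = 1, D_0 = diag(−3/8, −1/4), D_1 = [[0,1/2],[1/2,0]], D_2 = [[0,1/2],[1/√2,0]], and L(ρ) = D_0ρ + ρD_0* + D_1ρD_1* + D_2ρD_2*. Then a density matrix ρ satisfies L(ρ) = 0 if and only if ρ = diag(2/5, 3/5) (so ρ_inv = diag(2/5,3/5) is the unique invariant density matrix); m := Tr(D_1ρ_invD_1*) − Tr(D_2ρ_invD_2*) = −1/10; the matrix J = (1/10)·diag(−1, 1) has Tr(J) = 0 and satisfies L*(J) = −D_1*D_1 + D_2*D_2 + m·I₂, where L*(X) = D_0*X + XD_0 + D_1*XD_1 + D_2*XD_2; and σ² := Tr( ρ_inv [ −2mJ + D_1*D_1 + D_2*D_2 + 2D_1*JD_1 − 2D_2*JD_2 ]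 ) = 73/125. -/
/-!
Statement 18: Second example on ℤ: with `D₀ = diag(-3/8, -1/4)`,
`D₁ = [[0,1/2],[1/2,0]]`, `D₂ = [[0,1/2],[1/√2,0]]`, the unique invariant density matrix
is `ρ_inv = diag(2/5, 3/5)`, `m = -1/10`, `J = (1/10)·diag(-1,1)` is the trace-zero
solution of `L*(J) = -D₁*D₁ + D₂*D₂ + m·I₂`, and `σ² = 73/125`.
-/

open Matrix
open scoped ComplexOrder

theorem stmt_18
    (D₀ D₁ D₂ ρinv J : Matrix (Fin 2) (Fin 2) ℂ) (m : ℂ)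
    (hD₀ : D₀ = !![-(3/8 : ℂ), 0; 0, -(1/4 : ℂ)])
    (hD₁ : D₁ = !![0, (1/2 : ℂ); (1/2 : ℂ), 0])
    (hD₂ : D₂ = !![0, (1/2 : ℂ); ((Real.sqrt 2 : ℂ))⁻¹, 0])
    (hρinv : ρinv = !![(2/5 : ℂ), 0; 0, (3/5 : ℂ)])
    (hJ : J = (10⁻¹ : ℂ) • !![-1, 0; 0, 1])
    (hm : m = Matrix.trace (D₁ * ρinv * D₁ᴴ) - Matrix.trace (D₂ * ρinv * D₂ᴴ))
    (L : Matrix (Fin 2) (Fin 2) ℂ →ₗ[ℂ] Matrix (Fin 2) (Fin 2) ℂ)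
    (hL : ∀ ρ, L ρ = D₀ * ρ + ρ * D₀ᴴ + D₁ * ρ * D₁ᴴ + D₂ * ρ * D₂ᴴ) :
    (∀ ρ : Matrix (Fin 2) (Fin 2) ℂ, ρ.PosSemidef → ρ.trace = 1 →
      (L ρ = 0 ↔ ρ = ρinv)) ∧
    m = -(1/10 : ℂ) ∧
    J.trace = 0 ∧
    D₀ᴴ * J + J * D₀ + D₁ᴴ * J * D₁ + D₂ᴴ * J * D₂ =
      -(D₁ᴴ * D₁) + D₂ᴴ * D₂ + m • (1 : Matrix (Fin 2) (Fin 2) ℂ) ∧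
    Matrix.trace (ρinv *
        ((-2 * m) • J + D₁ᴴ * D₁ + D₂ᴴ * D₂ + (2 : ℂ) • (D₁ᴴ * J * D₁) -
          (2 : ℂ) • (D₂ᴴ * J * D₂))) = 73 / 125 := by
  obtain ⟨s, hs⟩ : ∃ s : ℂ, s = ((Real.sqrt 2 : ℂ))⁻¹ := ⟨_, rfl⟩
  have hss : s * s = 1 / 2 := by
    rw [hs, ← mul_inv, ← Complex.ofReal_mul, Real.mul_self_sqrt (by norm_num)]
    norm_num
  have hst : (starRingEnd ℂ) s = s := by
    rw [hs, map_inv₀, Complex.conj_ofReal]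
  rw [← hs] at hD₂
  clear hs
  have e0 : D₀ᴴ = !![-(3/8 : ℂ), 0; 0, -(1/4 : ℂ)] := by
    subst hD₀
    ext i j
    fin_cases i <;> fin_cases j <;> simp [Matrix.conjTranspose_apply]
  have e1 : D₁ᴴ = !![0, (1/2 : ℂ); (1/2 : ℂ), 0] := by
    subst hD₁
    ext i j
    fin_cases i <;> fin_cases j <;> simp [Matrix.conjTranspose_apply]
  have e2 : D₂ᴴ = !![0, s; (1/2 : ℂ), 0] := by
    subst hD₂
    ext i j
    fin_cases i <;> fin_cases j <;> simp [Matrix.conjTranspose_apply, hst]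
  have hm' : m = -(1/10 : ℂ) := by
    rw [hm, e1, e2, hD₁, hD₂, hρinv]
    simp [Matrix.trace_fin_two, Matrix.mul_apply, Fin.sum_univ_two]
    linear_combination (-2/5 : ℂ) * hss
  clear hm
  refine ⟨?_, hm', ?_, ?_, ?_⟩
  · intro ρ _ htr
    rw [hL, e0, e1, e2, hD₀, hD₁, hD₂, hρinv]
    rw [Matrix.trace_fin_two] at htr
    constructor
    · intro h
      have h00 := congrFun (congrFun h 0) 0
      have h01 := congrFun (congrFun h 0) 1
      have h10 := congrFun (congrFun h 1) 0
      simp [Matrix.mul_apply, Matrix.vecMul, dotProduct, Fin.sum_univ_two] at h00 h01 h10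
      have k00 : ρ 0 0 = 2/5 := by linear_combination (-4/5 : ℂ) * h00 + (2/5 : ℂ) * htr
      have k11 : ρ 1 1 = 3/5 := by linear_combination htr - k00
      have hsum : ρ 0 1 + ρ 1 0 = 0 := by
        have h1 : (s/2 - 3/8) * (ρ 0 1 + ρ 1 0) = 0 := by linear_combination h01 + h10
        linear_combination (-64 : ℂ) * (s/2 + 3/8) * h1 + 16 * (ρ 0 1 + ρ 1 0) * hss
      have hdif : ρ 0 1 - ρ 1 0 = 0 := by
        have h1 : (s/2 + 7/8) * (ρ 0 1 - ρ 1 0) = 0 := by linear_combination h10 - h01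
        linear_combination (-64/41 : ℂ) * (s/2 - 7/8) * h1 + 16/41 * (ρ 0 1 - ρ 1 0) * hss
      have k01 : ρ 0 1 = 0 := by linear_combination (hsum + hdif) / 2
      have k10 : ρ 1 0 = 0 := by linear_combination (hsum - hdif) / 2
      ext i j
      fin_cases i <;> fin_cases j <;> simp [k00, k01, k10, k11]
    · intro h
      subst h
      ext i j
      fin_cases i <;> fin_cases j <;> simp [Matrix.mul_apply, Fin.sum_univ_two]
      · norm_num
      · linear_combination (2/5 : ℂ) * hss
  · rw [hJ]
    simp [Matrix.trace_fin_two]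
  · rw [e0, e1, e2, hD₀, hD₁, hD₂, hJ, hm']
    ext i j
    fin_cases i <;> fin_cases j <;> simp [Matrix.mul_apply, Fin.sum_univ_two]
    · linear_combination (-9/10 : ℂ) * hss
    · norm_num
  · rw [e1, e2, hD₁, hD₂, hJ, hm', hρinv]
    simp [Matrix.trace_fin_two, Matrix.mul_apply, Fin.sum_univ_two]
    linear_combination (8/25 : ℂ) * hss
end
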